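/- arXiv:1609.03128 — 2 statements merged into one kernel-verified Lean document; each statement's English description precedes it below -/
import Mathlib

section
/- For every n ≥ 2, the Haglund–Loehr zeta map of type B_n, sending (π,v) to (ζ_B(π), d_B(π,v)), is a bijection from Vert(B_n) onto Diag(B_n). -/
inductive Step
  | N : Step
  | E : Step
  deriving DecidableEq

/-- The number of East steps strictly preceding the `k`-th North step. -/
def ebn : List Step → ℕ → ℕ
  | _, 0 => 0
  | [], _ + 1 => 0
  | Step.E :: rest, k + 1 => ebn rest (k + 1) + 1
  | Step.N :: rest, k + 1 => ebn rest k

/-- A lattice path with `a` East steps and `b` North steps. -/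
def IsLatticePath (a b : ℕ) (π : List Step) : Prop :=
  π.count Step.E = a ∧ π.count Step.N = b

/-- A ballot path of length `m`: every prefix has at least as many `N`s as `E`s. -/
def IsBallotPath (m : ℕ) (β : List Step) : Prop :=
  β.length = m ∧ ∀ k : ℕ, (β.take k).count Step.E ≤ (β.take k).count Step.N

/-- `i` is a rise: the `i`-th North step is immediately followed by a North step. -/
def IsRise (π : List Step) (i : ℕ) : Prop :=
  ∃ p : ℕ, π[p]? = some Step.N ∧ π[p + 1]? = some Step.N ∧ (π.take p).count Step.N + 1 = i

/-- `(i,j)` is a valley: the `i`-th East step is immediately followed by the `j`-th North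
step; in addition if the path ends with an East step and consists of `i` East steps and
`j - 1` North steps, then `(i, j)` counts as a valley. -/
def IsValley (β : List Step) (i j : ℕ) : Prop :=
  (∃ p : ℕ, β[p]? = some Step.E ∧ β[p + 1]? = some Step.N ∧
      (β.take p).count Step.E + 1 = i ∧ (β.take (p + 1)).count Step.N + 1 = j) ∨
  (β.getLast? = some Step.E ∧ i = β.count Step.E ∧ j = β.count Step.N + 1)

/-- Read `a` from left to right, writing `N` for each entry `j` and `E` for each entry `j+1`. -/
def sPlusL (j : ℤ) (a : List ℤ) : List Step :=
  a.filterMap fun x => if x = j then some Step.N else if x = j + 1 then some Step.E else none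

/-- Read `a` from right to left, writing `N` for each entry `j` and `E` for each entry `j+1`. -/
def sPlusR (j : ℤ) (a : List ℤ) : List Step := sPlusL j a.reverse

/-- Read `a` from left to right, writing `N` for each entry `-j` and `E` for each entry `-j-1`. -/
def sMinusL (j : ℤ) (a : List ℤ) : List Step :=
  a.filterMap fun x => if x = -j then some Step.N else if x = -j - 1 then some Step.E else none

/-- Read `a` from right to left, writing `N` for each entry `-j` and `E` for each entry `-j-1`. -/
def sMinusR (j : ℤ) (a : List ℤ) : List Step := sMinusL j a.reverse

/-- `w` is the window `[w(1),…,w(n)]` of a signed permutation of rank `n`. -/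
def IsSignedPerm (n : ℕ) (w : Fin n → ℤ) : Prop :=
  (∀ i, 1 ≤ |w i| ∧ |w i| ≤ (n : ℤ)) ∧ Function.Injective fun i => |w i|

/-- Evaluation of (the window of) a signed permutation at any integer, via `w(-j) = -w(j)`
and `w(0) = 0`. -/
def evalSP {n : ℕ} (w : Fin n → ℤ) (j : ℤ) : ℤ :=
  if h : 1 ≤ j ∧ j ≤ (n : ℤ) then w ⟨(j - 1).toNat, by omega⟩
  else if h' : 1 ≤ -j ∧ -j ≤ (n : ℤ) then -w ⟨(-j - 1).toNat, by omega⟩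
  else 0

/-- Vertically labelled lattice paths of type `Cₙ` (also of type `Bₙ`). -/
def VertC (n : ℕ) : Set (List Step × (Fin n → ℤ)) :=
  {p : List Step × (Fin n → ℤ) | IsLatticePath n n p.1 ∧ IsSignedPerm n p.2 ∧
    (∀ i : ℕ, IsRise p.1 i → evalSP p.2 (i : ℤ) < evalSP p.2 ((i : ℤ) + 1)) ∧
    (p.1.head? = some Step.N → 0 < evalSP p.2 1)}

/-- The vector `λ(π)` of type `Bₙ` (1-based index). -/
def lamB (n : ℕ) (π : List Step) (i : ℕ) : ℤ :=
  if i = n then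
    (if (∑ k ∈ Finset.Icc 1 (n - 2), ebn π k) % 2 = 0 then
        2 * (ebn π n : ℤ) - (ebn π (n - 1) : ℤ)
      else 2 * (n : ℤ) + 1 - 2 * (ebn π n : ℤ) + (ebn π (n - 1) : ℤ))
  else (ebn π i : ℤ)

/-- The type `Bₙ` area vector (1-based index). -/
def areaBv (n : ℕ) (π : List Step) (i : ℕ) : ℤ :=
  if i = n then
    (if n % 4 = 0 ∨ n % 4 = 3 then lamB n π n - (n : ℤ) else (n : ℤ) + 1 - lamB n π n)
  else lamB n π i - (i : ℤ)

def areaBList (n : ℕ) (π : List Step) : List ℤ :=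
  (List.range n).map fun k => areaBv n π (k + 1)

/-- The type `Bₙ` zeta map. -/
def zetaB (n : ℕ) (π : List Step) : List Step :=
  (((List.range (2 * n)).reverse.map (fun jm =>
      sMinusR ((jm : ℤ) + 1) (areaBList n π) ++ sPlusL ((jm : ℤ) + 1) (areaBList n π))).flatten) ++
    sMinusR 0 (areaBList n π) ++ (Step.N :: sPlusL 0 (areaBList n π)).dropLast

/-- The type `Bₙ` diagonal reading word, as the list of its window entries. -/
def dBList (n : ℕ) (π : List Step) (v : Fin n → ℤ) : List ℤ :=
  let mult : ℕ → ℤ := fun j =>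
    if j = n ∧ (areaBv n π (n - 1) + areaBv n π n) % 2 = 0 then -1 else 1
  ((List.range (4 * n + 4)).map (fun i =>
    ((List.finRange n).filterMap (fun j =>
      if areaBv n π (j.val + 1) = -(i : ℤ) then some (mult (j.val + 1) * v j) else none)) ++
    ((List.finRange n).reverse.filterMap (fun j =>
      if areaBv n π (j.val + 1) = (i : ℤ) + 1 then some (-(mult (j.val + 1) * v j))
      else none)))).flatten

/-- The type `Bₙ` diagonal reading word. -/
def dB (n : ℕ) (π : List Step) (v : Fin n → ℤ) : Fin n → ℤ :=
  fun i => (dBList n π v).getD i.val 0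

/-- Diagonally labelled ballot paths of type `Bₙ`. -/
def DiagB (n : ℕ) : Set (List Step × (Fin n → ℤ)) :=
  {p : List Step × (Fin n → ℤ) | IsBallotPath (2 * n) p.1 ∧ IsSignedPerm n p.2 ∧
    ∀ i j : ℕ, IsValley p.1 i j →
      evalSP p.2 ((n : ℤ) + 1 - j) < evalSP p.2 ((n : ℤ) + 1 - i)}

namespace HLZeta

/-! ### Concatenation of blocks in decreasing order -/

/-- The concatenation `f (m - 1) ++ ⋯ ++ f 1 ++ f 0`. -/
def descFlat {α : Type*} (m : ℕ) (f : ℕ → List α) : List α :=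
  ((List.range m).reverse.map f).flatten

section DescFlat

variable {α β : Type*}

@[simp] theorem descFlat_zero (f : ℕ → List α) : descFlat 0 f = [] := rfl

theorem descFlat_succ (m : ℕ) (f : ℕ → List α) : descFlat (m + 1) f = f m ++ descFlat m f := by
  simp [descFlat, List.range_succ]

theorem descFlat_succ' (m : ℕ) (f : ℕ → List α) :
    descFlat (m + 1) f = descFlat m (fun j => f (j + 1)) ++ f 0 := by
  simp [descFlat, List.range_succ_eq_map, Function.comp_def]

theorem descFlat_congr {m : ℕ} {f g : ℕ → List α} (h : ∀ j < m, f j = g j) :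
    descFlat m f = descFlat m g := by
  induction m with
  | zero => rfl
  | succ m ih => rw [descFlat_succ, descFlat_succ, h m (by omega), ih fun j hj => h j (by omega)]

theorem descFlat_extend {m M : ℕ} (hm : m ≤ M) {f : ℕ → List α} (h : ∀ j, m ≤ j → f j = []) :
    descFlat M f = descFlat m f := by
  induction M, hm using Nat.le_induction with
  | base => rfl
  | succ k hk ih => rw [descFlat_succ, h k hk, ih, List.nil_append]

theorem descFlat_regroup (m : ℕ) (f g : ℕ → List α) :
    g m ++ descFlat m (fun j => f j ++ g j) = descFlat m (fun j => g (j + 1) ++ f j) ++ g 0 := by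
  induction m with
  | zero => simp
  | succ m ih => rw [descFlat_succ, descFlat_succ]; simp only [List.append_assoc, ih]

theorem descFlat_append_bottom (m : ℕ) (f : ℕ → List α) (c : List α) :
    descFlat (m + 1) (fun j => f j ++ if j = 0 then c else []) = descFlat (m + 1) f ++ c := by
  simp [descFlat_succ']

theorem map_descFlat (m : ℕ) (f : ℕ → List α) (g : α → β) :
    (descFlat m f).map g = descFlat m fun j => (f j).map g := by
  simp [descFlat, List.map_flatten, Function.comp_def]

theorem filterMap_descFlat (m : ℕ) (f : ℕ → List α) (g : α → Option β) :
    (descFlat m f).filterMap g = descFlat m fun j => (f j).filterMap g := by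
  induction m with
  | zero => rfl
  | succ m ih => simp [descFlat_succ, ih]

theorem reverse_flatten_map_range (m : ℕ) (f : ℕ → List α) :
    ((List.range m).map f).flatten.reverse = descFlat m fun j => (f j).reverse := by
  simp [descFlat, List.reverse_flatten, Function.comp_def]

end DescFlat

/-! ### Words of levels of a vector -/

/-- Consecutive entries decrease by at most one. -/
def SlowDescent (a : List ℤ) : Prop := a.IsChain fun x y => x - 1 ≤ y

/-- The symmetric vector `(-aₙ, …, -a₁, 0, a₁, …, aₙ)`. -/
def symVec (a : List ℤ) : List ℤ := a.reverse.map (fun x => -x) ++ 0 :: a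

theorem sPlusL_nil (j : ℤ) : sPlusL j [] = [] := rfl

theorem sPlusL_cons (j x : ℤ) (a : List ℤ) :
    sPlusL j (x :: a) =
      if x = j then Step.N :: sPlusL j a
      else if x = j + 1 then Step.E :: sPlusL j a else sPlusL j a := by
  unfold sPlusL; rw [List.filterMap_cons]; split_ifs <;> simp_all

theorem sPlusL_append (j : ℤ) (a b : List ℤ) :
    sPlusL j (a ++ b) = sPlusL j a ++ sPlusL j b := by simp [sPlusL]

theorem sMinusR_eq (j : ℤ) (a : List ℤ) :
    sMinusR j a = sPlusL j (a.reverse.map fun x => -x) := by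
  simp only [sMinusR, sMinusL, sPlusL, List.filterMap_map]
  congr 1
  funext x
  simp only [Function.comp]
  have h1 : x = -j ↔ -x = j := by omega
  have h2 : x = -j - 1 ↔ -x = j + 1 := by omega
  simp [h1, h2]

theorem sPlusL_eq_nil {j : ℤ} {a : List ℤ} (h : ∀ x ∈ a, x ≠ j ∧ x ≠ j + 1) :
    sPlusL j a = [] := by
  simp only [sPlusL, List.filterMap_eq_nil_iff]
  intro x hx
  simp [h x hx]

theorem count_N_sPlusL (j : ℤ) (a : List ℤ) : (sPlusL j a).count Step.N = a.count j := by
  induction a with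
  | nil => rfl
  | cons x a ih => rw [sPlusL_cons]; split_ifs <;> simp_all

theorem count_E_sPlusL (j : ℤ) (a : List ℤ) : (sPlusL j a).count Step.E = a.count (j + 1) := by
  induction a with
  | nil => rfl
  | cons x a ih => rw [sPlusL_cons]; split_ifs <;> simp_all

/-- The concatenation of the level words of a vector, from level `m - 1` down to level `0`. -/
def zetaWord (m : ℕ) (a : List ℤ) : List Step := descFlat m fun j => sPlusL j a

theorem head?_sPlusL {j x : ℤ} {a : List ℤ} (h : SlowDescent (x :: a)) (hx : j + 1 ≤ x) :
    (sPlusL j (x :: a)).head? ≠ some Step.N := by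
  induction a generalizing x with
  | nil =>
    rw [sPlusL_cons, sPlusL_nil]
    split_ifs <;> first | omega | simp
  | cons y a ih =>
    rw [sPlusL_cons]
    split_ifs with h1 h2
    · omega
    · simp
    · have := List.isChain_cons_cons.1 h
      exact ih this.2 (by omega)

theorem slowDescent_neg_reverse {a : List ℤ} :
    SlowDescent (a.reverse.map fun x => -x) ↔ SlowDescent a := by
  unfold SlowDescent
  rw [List.isChain_map, List.isChain_reverse]
  constructor <;> intro h <;> refine h.imp ?_ <;> intros <;> omega

/-- The involution exchanging the two kinds of steps. -/
def swapStep : Step → Step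
  | Step.N => Step.E
  | Step.E => Step.N

theorem sPlusL_neg_reverse (j : ℤ) (a : List ℤ) :
    sPlusL (-j - 1) (a.reverse.map fun x => -x) = (sPlusL j a).reverse.map swapStep := by
  induction a with
  | nil => rfl
  | cons x a ih =>
    rw [List.reverse_cons, List.map_append, sPlusL_append, ih, sPlusL_cons]
    simp only [List.map_cons, List.map_nil, sPlusL_cons, sPlusL_nil]
    split_ifs <;> first | omega | simp [swapStep]

theorem getLast?_sPlusL {j x : ℤ} {a : List ℤ} (h : SlowDescent (a ++ [x])) (hx : x ≤ j) :
    (sPlusL j (a ++ [x])).getLast? ≠ some Step.E := by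
  have h1 := head?_sPlusL (j := -j - 1) (x := -x) (a := a.reverse.map fun x => -x)
    (by simpa using slowDescent_neg_reverse.2 h) (by omega)
  have h2 := sPlusL_neg_reverse j (a ++ [x])
  simp only [List.reverse_append, List.reverse_cons, List.reverse_nil, List.nil_append,
    List.singleton_append, List.map_cons] at h2
  rw [h2] at h1
  intro h3
  apply h1
  simp [h3, swapStep]

/-- A vector with slow descents is determined by its level words. -/
theorem eq_of_sPlusL_eq {a b : List ℤ} (ha : SlowDescent a) (hb : SlowDescent b)
    (h : ∀ j, sPlusL j a = sPlusL j b) : a = b := by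
  induction a generalizing b with
  | nil =>
    cases b with
    | nil => rfl
    | cons y b => have := h y; simp [sPlusL_cons, sPlusL_nil] at this
  | cons x a ih =>
    cases b with
    | nil => have := h x; simp [sPlusL_cons, sPlusL_nil] at this
    | cons y b =>
      have key : ∀ {x y : ℤ} {a b : List ℤ}, SlowDescent (y :: b) →
          (∀ j, sPlusL j (x :: a) = sPlusL j (y :: b)) → ¬ x < y := by
        intro x y a b hb h hxy
        have h1 := head?_sPlusL (j := x) hb (by omega)
        rw [← h x, sPlusL_cons] at h1
        simp at h1
      have hxy : x = y := by
        have h1 := key hb h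
        have h2 := key ha fun j => (h j).symm
        omega
      subst hxy
      congr 1
      refine ih ha.of_cons hb.of_cons fun j => ?_
      have := h j
      rw [sPlusL_cons, sPlusL_cons] at this
      split_ifs at this <;> simpa using this

/-! ### Recovering the vector from the word -/

theorem append_cancel_of_getLast? {X X' U U' : List Step} (h : X ++ U = X' ++ U')
    (hX : X.getLast? ≠ some Step.E) (hX' : X'.getLast? ≠ some Step.E)
    (hc : U.count Step.N = U'.count Step.N) : X = X' ∧ U = U' := by
  have key : ∀ {Y c U U' : List Step}, U = c ++ U' → U.count Step.N = U'.count Step.N →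
      (Y ++ c).getLast? ≠ some Step.E → c = [] := by
    intro Y c U U' h hc hY
    rcases List.eq_nil_or_concat c with rfl | ⟨d, s, rfl⟩
    · rfl
    · cases s with
      | E => simp at hY
      | N => subst h; simp at hc; omega
  rcases List.append_eq_append_iff.1 h with ⟨c, h1, h2⟩ | ⟨c, h1, h2⟩
  · have := key (Y := X) h2 hc (h1 ▸ hX')
    subst this; simp_all
  · have := key (Y := X') h2 hc.symm (h1 ▸ hX)
    subst this; simp_all

theorem getLast?_descFlat {m : ℕ} {f : ℕ → List Step}
    (h : ∀ j, (f j).getLast? ≠ some Step.E) : (descFlat m f).getLast? ≠ some Step.E := by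
  induction m generalizing f with
  | zero => simp
  | succ m ih =>
    rw [descFlat_succ', List.getLast?_append]
    have h0 := h 0
    cases h1 : (f 0).getLast? with
    | none => simpa using ih fun j => h (j + 1)
    | some s => rw [h1] at h0; simpa using h0

theorem eq_of_descFlat_eq {m : ℕ} {f g : ℕ → List Step}
    (hf : ∀ j, (f j).getLast? ≠ some Step.E) (hg : ∀ j, (g j).getLast? ≠ some Step.E)
    (hfc : ∀ j, (f (j + 1)).count Step.N = (f j).count Step.E)
    (hgc : ∀ j, (g (j + 1)).count Step.N = (g j).count Step.E)
    (h0 : (f 0).count Step.N = (g 0).count Step.N) (h : descFlat m f = descFlat m g) :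
    ∀ j < m, f j = g j := by
  induction m generalizing f g with
  | zero => intro j hj; omega
  | succ m ih =>
    rw [descFlat_succ', descFlat_succ'] at h
    obtain ⟨h1, h2⟩ := append_cancel_of_getLast? h (getLast?_descFlat fun j => hf (j + 1))
      (getLast?_descFlat fun j => hg (j + 1)) h0
    have := ih (fun j => hf (j + 1)) (fun j => hg (j + 1)) (fun j => hfc (j + 1))
      (fun j => hgc (j + 1)) (by rw [hfc, hgc, h2]) h1
    rintro (_ | j) hj
    · exact h2
    · exact this j (by omega)

theorem count_N_zetaWord (m : ℕ) (a : List ℤ) :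
    (zetaWord m a).count Step.N + a.count (m : ℤ) = (zetaWord m a).count Step.E + a.count 0 := by
  unfold zetaWord
  induction m with
  | zero => simp
  | succ m ih =>
    rw [descFlat_succ, List.count_append, List.count_append, count_N_sPlusL, count_E_sPlusL]
    push_cast
    omega

theorem symVec_neg_reverse (a : List ℤ) : (symVec a).reverse.map (fun x => -x) = symVec a := by
  simp [symVec]

theorem symVec_injective : Function.Injective symVec := by
  intro a b h
  have hl : a.length = b.length := by
    have := congrArg List.length h
    simp [symVec] at this
    omega
  have := List.append_inj_right h (by simpa using hl)
  simpa using this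

theorem slowDescent_symVec {a : List ℤ} : SlowDescent (symVec a) ↔ SlowDescent (0 :: a) := by
  unfold symVec
  constructor
  · intro h
    exact (List.isChain_split.1 h).2
  · intro h
    refine List.isChain_split.2 ⟨?_, h⟩
    simpa [SlowDescent] using slowDescent_neg_reverse.2 h

theorem symVec_concat (a : List ℤ) (x : ℤ) :
    symVec (a ++ [x]) = (-x :: symVec a) ++ [x] := by
  simp [symVec]

theorem getLast?_sPlusL_symVec {a : List ℤ} {x : ℤ} (h : SlowDescent (0 :: (a ++ [x])))
    (hx : x ≤ 0) (j : ℕ) : (sPlusL j (symVec (a ++ [x]))).getLast? ≠ some Step.E := by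
  have := slowDescent_symVec.2 h
  rw [symVec_concat] at this ⊢
  exact getLast?_sPlusL this (by omega)

theorem mem_symVec {a : List ℤ} {x : ℤ} (hx : x ∈ symVec a) : x = 0 ∨ x ∈ a ∨ -x ∈ a := by
  simp only [symVec, List.mem_append, List.mem_map, List.mem_reverse, List.mem_cons] at hx
  rcases hx with ⟨y, hy, rfl⟩ | h | h
  · simp [hy]
  · exact Or.inl h
  · exact Or.inr (Or.inl h)

theorem zetaWord_eq_dropLast_concat_N {a : List ℤ} {x : ℤ} (h : SlowDescent (0 :: (a ++ [x])))
    (hx : x ≤ 0) {m : ℕ} :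
    zetaWord (m + 1) (symVec (a ++ [x])) =
      (zetaWord (m + 1) (symVec (a ++ [x]))).dropLast ++ [Step.N] := by
  have h1 : (zetaWord (m + 1) (symVec (a ++ [x]))).getLast? ≠ some Step.E :=
    getLast?_descFlat (getLast?_sPlusL_symVec h hx)
  have h2 : zetaWord (m + 1) (symVec (a ++ [x])) ≠ [] := by
    intro h2
    have : (sPlusL ((0 : ℕ) : ℤ) (symVec (a ++ [x]))).count Step.N = 0 := by
      rw [zetaWord, descFlat_succ', List.append_eq_nil_iff] at h2
      rw [h2.2]; rfl
    rw [count_N_sPlusL, List.count_eq_zero] at this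
    simp [symVec] at this
  rw [List.getLast?_eq_some_getLast h2] at h1
  conv_lhs => rw [← List.dropLast_append_getLast h2]
  congr 2
  cases h3 : (zetaWord (m + 1) (symVec (a ++ [x]))).getLast h2 with
  | N => rfl
  | E => simp [h3] at h1

theorem zetaWord_injective {m : ℕ} {a b : List ℤ} {x y : ℤ}
    (ha : SlowDescent (0 :: (a ++ [x]))) (hx : x ≤ 0) (hb : SlowDescent (0 :: (b ++ [y])))
    (hy : y ≤ 0) (ham : ∀ z ∈ a ++ [x], |z| ≤ m) (hbm : ∀ z ∈ b ++ [y], |z| ≤ m)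
    (h : (zetaWord (m + 1) (symVec (a ++ [x]))).dropLast =
      (zetaWord (m + 1) (symVec (b ++ [y]))).dropLast) : a ++ [x] = b ++ [y] := by
  have hbd : ∀ {c : List ℤ}, (∀ z ∈ c, |z| ≤ m) → ∀ z ∈ symVec c, z ≤ m := by
    intro c hc z hz
    rcases mem_symVec hz with rfl | h | h
    · omega
    · have := abs_le.1 (hc z h); omega
    · have := abs_le.1 (hc _ h); omega
  have hZ : zetaWord (m + 1) (symVec (a ++ [x])) = zetaWord (m + 1) (symVec (b ++ [y])) := by
    rw [zetaWord_eq_dropLast_concat_N ha hx, zetaWord_eq_dropLast_concat_N hb hy, h]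
  have htop : ∀ {c : List ℤ}, (∀ z ∈ c, |z| ≤ m) → (symVec c).count ((m + 1 : ℕ) : ℤ) = 0 := by
    intro c hc
    rw [List.count_eq_zero]
    intro hm
    have := hbd hc _ hm
    push_cast at this
    omega
  have h0 : (symVec (a ++ [x])).count 0 = (symVec (b ++ [y])).count 0 := by
    have h1 := count_N_zetaWord (m + 1) (symVec (a ++ [x]))
    have h2 := count_N_zetaWord (m + 1) (symVec (b ++ [y]))
    rw [htop ham] at h1
    rw [htop hbm] at h2
    rw [hZ] at h1
    omega
  have hlev := eq_of_descFlat_eq (getLast?_sPlusL_symVec ha hx) (getLast?_sPlusL_symVec hb hy)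
    (fun j => by rw [count_N_sPlusL, count_E_sPlusL]; push_cast; rfl)
    (fun j => by rw [count_N_sPlusL, count_E_sPlusL]; push_cast; rfl)
    (by rw [count_N_sPlusL, count_N_sPlusL]; exact_mod_cast h0) hZ
  have hnat : ∀ j : ℕ, sPlusL j (symVec (a ++ [x])) = sPlusL j (symVec (b ++ [y])) := by
    intro j
    by_cases hj : j < m + 1
    · exact hlev j hj
    · rw [sPlusL_eq_nil, sPlusL_eq_nil]
      · intro z hz; have := hbd hbm z hz; omega
      · intro z hz; have := hbd ham z hz; omega
  refine symVec_injective (eq_of_sPlusL_eq (slowDescent_symVec.2 ha) (slowDescent_symVec.2 hb) ?_)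
  intro j
  rcases le_or_gt 0 j with hj | hj
  · obtain ⟨k, rfl⟩ := Int.eq_ofNat_of_zero_le hj
    exact hnat k
  · obtain ⟨k, hk⟩ := Int.eq_ofNat_of_zero_le (show 0 ≤ -j - 1 by omega)
    have h1 := sPlusL_neg_reverse k (symVec (a ++ [x]))
    have h2 := sPlusL_neg_reverse k (symVec (b ++ [y]))
    rw [symVec_neg_reverse, show -(k : ℤ) - 1 = j by omega] at h1 h2
    rw [h1, h2, hnat]

/-! ### Labelled words -/

/-- The level word of a labelled vector, each step carrying the label of its entry. -/
def labWord (j : ℤ) (P : List (ℤ × ℤ)) : List (Step × ℤ) :=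
  P.filterMap fun x =>
    if x.1 = j then some (Step.N, x.2) else if x.1 = j + 1 then some (Step.E, x.2) else none

/-- The labelled version of `symVec`. -/
def symPair (Q : List (ℤ × ℤ)) : List (ℤ × ℤ) :=
  Q.reverse.map (fun x => -x) ++ 0 :: Q

/-- The labelled version of `zetaWord`. -/
def labZeta (m : ℕ) (P : List (ℤ × ℤ)) : List (Step × ℤ) := descFlat m fun j => labWord j P

/-- Labels increase along steps down by one. -/
def RiseRel (s t : ℤ × ℤ) : Prop := t.1 = s.1 - 1 → s.2 < t.2

/-- Labels increase along valleys. -/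
def ValleyRel (s t : Step × ℤ) : Prop := s.1 = Step.E → t.1 = Step.N → s.2 < t.2

/-- The labels of all steps of a given kind. -/
def stepLabels (s : Step) (L : List (Step × ℤ)) : List ℤ :=
  L.filterMap fun x => if x.1 = s then some x.2 else none

/-- The labels of all entries of a given value. -/
def valLabels (x : ℤ) (P : List (ℤ × ℤ)) : List ℤ :=
  P.filterMap fun y => if y.1 = x then some y.2 else none

theorem labWord_cons (j : ℤ) (x : ℤ × ℤ) (P : List (ℤ × ℤ)) :
    labWord j (x :: P) =
      if x.1 = j then (Step.N, x.2) :: labWord j P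
      else if x.1 = j + 1 then (Step.E, x.2) :: labWord j P else labWord j P := by
  unfold labWord; rw [List.filterMap_cons]; split_ifs <;> simp_all

theorem map_fst_labWord (j : ℤ) (P : List (ℤ × ℤ)) :
    (labWord j P).map Prod.fst = sPlusL j (P.map Prod.fst) := by
  induction P with
  | nil => rfl
  | cons x P ih => rw [labWord_cons, List.map_cons, sPlusL_cons]; split_ifs <;> simp [ih]

theorem map_fst_symPair (Q : List (ℤ × ℤ)) :
    (symPair Q).map Prod.fst = symVec (Q.map Prod.fst) := by
  simp [symPair, symVec, Function.comp_def]

theorem map_fst_labZeta (m : ℕ) (P : List (ℤ × ℤ)) :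
    (labZeta m P).map Prod.fst = zetaWord m (P.map Prod.fst) := by
  simp [labZeta, zetaWord, map_descFlat, map_fst_labWord]

theorem symPair_neg_reverse (Q : List (ℤ × ℤ)) :
    (symPair Q).reverse.map (fun x => -x) = symPair Q := by
  simp [symPair]

theorem isChain_labWord {j : ℤ} {P : List (ℤ × ℤ)} (hP : SlowDescent (P.map Prod.fst)) :
    (labWord j P).IsChain ValleyRel ↔
      P.IsChain fun s t => s.1 = j + 1 → t.1 = j → s.2 < t.2 := by
  induction P with
  | nil => simp [labWord]
  | cons s P ih =>
    have hP' : SlowDescent (P.map Prod.fst) := List.IsChain.of_cons hP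
    rw [labWord_cons, List.isChain_cons]
    split_ifs with h1 h2
    · rw [List.isChain_cons, ih hP']
      simp [ValleyRel, h1]
    · rw [List.isChain_cons, ih hP']
      refine and_congr_left fun _ => ?_
      cases P with
      | nil => simp [labWord]
      | cons t P =>
        have h3 : s.1 - 1 ≤ t.1 := (List.isChain_cons_cons.1 hP).1
        by_cases h4 : t.1 = j
        · simp [labWord_cons, h4, ValleyRel, h2]
        · have h5 := head?_sPlusL (j := j) hP' (by omega)
          rw [← List.map_cons, ← map_fst_labWord, List.head?_map] at h5
          constructor
          · simp [h4]
          · rintro - y hy - h6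
            rw [Option.mem_def] at hy
            rw [hy] at h5
            simp [h6] at h5
    · rw [ih hP']
      simp [h2]

theorem isChain_descFlat {m : ℕ} {f : ℕ → List (Step × ℤ)}
    (h : ∀ j, ((f j).map Prod.fst).getLast? ≠ some Step.E) :
    (descFlat m f).IsChain ValleyRel ↔ ∀ j < m, (f j).IsChain ValleyRel := by
  induction m with
  | zero => simp
  | succ m ih =>
    rw [descFlat_succ, List.isChain_append, ih]
    constructor
    · rintro ⟨h1, h2, -⟩ j hj
      rcases Nat.lt_succ_iff_lt_or_eq.1 hj with h3 | rfl
      · exact h2 j h3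
      · exact h1
    · intro h1
      refine ⟨h1 m (by omega), fun j hj => h1 j (by omega), ?_⟩
      intro x hx y _ hxE
      have := h m
      rw [Option.mem_def] at hx
      rw [List.getLast?_map, hx] at this
      simp [hxE] at this

theorem isChain_riseRel_symPair (Q : List (ℤ × ℤ)) :
    (symPair Q).IsChain RiseRel ↔ (0 :: Q).IsChain RiseRel := by
  unfold symPair
  rw [List.isChain_split, and_iff_right_iff_imp]
  intro h
  have h1 : List.map (fun x => -x) Q.reverse ++ [0] = (0 :: Q).reverse.map (fun x => -x) := by
    simp
  rw [h1, List.isChain_map, List.isChain_reverse]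
  refine h.imp ?_
  intro s t hst h2
  simp only [Prod.fst_neg, Prod.snd_neg] at h2 ⊢
  have := hst (by omega)
  omega

theorem isChain_labZeta {Q : List (ℤ × ℤ)} {y : ℤ × ℤ} {m : ℕ}
    (hQ : SlowDescent (0 :: (Q ++ [y]).map Prod.fst)) (hy : y.1 ≤ 0)
    (hm : ∀ x ∈ Q ++ [y], |x.1| ≤ m) :
    (labZeta (m + 1) (symPair (Q ++ [y]))).IsChain ValleyRel ↔
      (0 :: (Q ++ [y])).IsChain RiseRel := by
  have hs : SlowDescent ((symPair (Q ++ [y])).map Prod.fst) := by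
    rw [map_fst_symPair, slowDescent_symVec]; exact hQ
  have hb : ∀ x ∈ symPair (Q ++ [y]), x.1 ≤ m := by
    intro x hx
    have hx' : x.1 ∈ symVec ((Q ++ [y]).map Prod.fst) := by
      rw [← map_fst_symPair]; exact List.mem_map_of_mem hx
    rcases mem_symVec hx' with h | h | h
    · omega
    · obtain ⟨z, hz, h⟩ := List.mem_map.1 h
      have := abs_le.1 (hm z hz); omega
    · obtain ⟨z, hz, h⟩ := List.mem_map.1 h
      have := abs_le.1 (hm z hz); omega
  unfold labZeta
  rw [isChain_descFlat, ← isChain_riseRel_symPair]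
  · have h0 : ∀ j : ℕ, (labWord j (symPair (Q ++ [y]))).IsChain ValleyRel ↔ _ :=
      fun j => isChain_labWord hs
    simp only [h0]
    constructor
    · intro h
      have h1 : (symPair (Q ++ [y])).IsChain fun s t => 0 ≤ t.1 → RiseRel s t := by
        rw [List.isChain_iff_getElem]
        intro i hi hi0 hst
        obtain ⟨k, hk⟩ := Int.eq_ofNat_of_zero_le hi0
        have hb' := hb _ (List.getElem_mem (show i < _ by omega))
        exact List.isChain_iff_getElem.1 (h k (by omega)) i hi (by omega) hk
      have h2 : (symPair (Q ++ [y])).IsChain fun s t => s.1 ≤ 0 → RiseRel s t := by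
        rw [← symPair_neg_reverse, List.isChain_map, List.isChain_reverse]
        refine h1.imp ?_
        intro s t hst h2 h3
        simp only [Prod.fst_neg, Prod.snd_neg] at h2 h3 ⊢
        have := hst (by omega) (by omega)
        omega
      rw [List.isChain_iff_getElem] at h1 h2 ⊢
      intro i hi hst
      rcases le_or_gt 0 (symPair (Q ++ [y]))[i + 1].1 with h3 | h3
      · exact h1 i hi h3 hst
      · exact h2 i hi (by omega) hst
    · intro h j _
      refine h.imp ?_
      intro s t hst h1 h2
      exact hst (by omega)
  · intro j
    rw [map_fst_labWord, map_fst_symPair, List.map_append]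
    exact getLast?_sPlusL_symVec (by simpa using hQ) hy j

/-! ### The order of the labels -/

/-- The diagonal reading word of a labelled vector. -/
def readingWord (m : ℕ) (Q : List (ℤ × ℤ)) : List ℤ :=
  ((List.range m).map fun i : ℕ =>
    Q.filterMap (fun x => if x.1 = -(i : ℤ) then some x.2 else none) ++
    Q.reverse.filterMap (fun x => if x.1 = (i : ℤ) + 1 then some (-x.2) else none)).flatten

theorem stepLabels_N_labWord (j : ℤ) (P : List (ℤ × ℤ)) :
    stepLabels Step.N (labWord j P) = valLabels j P := by
  induction P with
  | nil => rfl
  | cons x P ih =>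
    rw [labWord_cons]
    simp only [stepLabels, valLabels] at ih ⊢
    split_ifs <;> simp_all

theorem stepLabels_E_labWord (j : ℤ) (P : List (ℤ × ℤ)) :
    stepLabels Step.E (labWord j P) = valLabels (j + 1) P := by
  induction P with
  | nil => rfl
  | cons x P ih =>
    rw [labWord_cons]
    simp only [stepLabels, valLabels] at ih ⊢
    split_ifs <;> simp_all

theorem stepLabels_N_labZeta (m : ℕ) (P : List (ℤ × ℤ)) :
    stepLabels Step.N (labZeta m P) = descFlat m fun j => valLabels j P := by
  simp only [← stepLabels_N_labWord]
  simp [stepLabels, labZeta, filterMap_descFlat]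

theorem stepLabels_E_labZeta (m : ℕ) (P : List (ℤ × ℤ)) :
    stepLabels Step.E (labZeta m P) = descFlat m fun j => valLabels ((j + 1 : ℕ) : ℤ) P := by
  push_cast
  simp only [← stepLabels_E_labWord]
  simp [stepLabels, labZeta, filterMap_descFlat]

theorem valLabels_eq_nil {x : ℤ} {P : List (ℤ × ℤ)} (h : ∀ y ∈ P, y.1 ≠ x) :
    valLabels x P = [] := by
  simp only [valLabels, List.filterMap_eq_nil_iff]
  intro y hy
  simp [h y hy]

theorem stepLabels_E_append (m : ℕ) (P : List (ℤ × ℤ)) (h : ∀ y ∈ P, y.1 < m) :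
    stepLabels Step.E (labZeta m P) ++ valLabels 0 P = stepLabels Step.N (labZeta m P) := by
  have := descFlat_regroup m (fun _ => []) fun j : ℕ => valLabels j P
  simp only [List.append_nil, List.nil_append] at this
  rw [stepLabels_E_labZeta, stepLabels_N_labZeta]
  push_cast at this ⊢
  rw [← this, valLabels_eq_nil, List.nil_append]
  intro y hy
  exact (h y hy).ne

theorem valLabels_symPair (j : ℕ) (Q : List (ℤ × ℤ)) :
    valLabels j (symPair Q) =
      ((valLabels (-j) Q).reverse.map (fun x => -x) ++ if j = 0 then [0] else []) ++
        valLabels j Q := by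
  have h : ∀ l : List (ℤ × ℤ), valLabels j (l.map fun x => -x) =
      (valLabels (-j) l).map fun x => -x := by
    intro l
    simp only [valLabels, List.filterMap_map, List.map_filterMap]
    congr 1
    funext x
    by_cases hx : x.1 = -j
    · simp [hx]
    · have : -x.1 ≠ j := by omega
      simp [hx, this]
  have h1 : valLabels (-j) Q.reverse = (valLabels (-j) Q).reverse := by
    simp [valLabels, List.filterMap_reverse]
  have h2 : valLabels j (0 :: Q) = (if j = 0 then [0] else []) ++ valLabels j Q := by
    rcases Nat.eq_zero_or_pos j with rfl | hj
    · simp [valLabels]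
    · have : (0 : ℤ) ≠ j := by omega
      simp [valLabels, this, hj.ne']
  have h3 : valLabels j (symPair Q) =
      valLabels j (Q.reverse.map fun x => -x) ++ valLabels j (0 :: Q) := by
    simp [valLabels, symPair]
  rw [h3, h, h1, h2, List.map_reverse, List.append_assoc]

theorem stepLabels_N_symPair {m : ℕ} {Q : List (ℤ × ℤ)} (h : ∀ x ∈ Q, x.1 ≤ m) :
    stepLabels Step.N (labZeta (m + 1) (symPair Q)) =
      (readingWord (m + 1) Q).reverse.map (fun x => -x) ++ 0 :: valLabels 0 Q := by
  have key := descFlat_regroup (m + 1)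
    (fun j => (valLabels (-j) Q).reverse.map (fun x => -x) ++ if j = 0 then [0] else [])
    fun j => valLabels j Q
  rw [stepLabels_N_labZeta]
  simp only [valLabels_symPair]
  rw [valLabels_eq_nil (x := ((m + 1 : ℕ) : ℤ)), List.nil_append] at key
  · rw [key]
    simp only [← List.append_assoc]
    rw [descFlat_append_bottom, readingWord, reverse_flatten_map_range, map_descFlat]
    have : (descFlat (m + 1) fun j : ℕ => valLabels ((j + 1 : ℕ) : ℤ) Q ++
          List.map (fun x => -x) (valLabels (-(j : ℤ)) Q).reverse) =
        descFlat (m + 1) fun j => List.map (fun x => -x)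
          (List.filterMap (fun x => if x.1 = -(j : ℤ) then some x.2 else none) Q ++
            List.filterMap (fun x => if x.1 = (j : ℤ) + 1 then some (-x.2) else none)
              Q.reverse).reverse := by
      refine descFlat_congr fun j _ => ?_
      rw [List.reverse_append, List.map_append]
      congr 1
      rw [← List.filterMap_reverse, List.reverse_reverse, List.map_filterMap]
      simp only [valLabels]
      congr 1
      funext x
      push_cast
      split_ifs <;> simp
    rw [this]
    simp
  · intro y hy
    have := h y hy
    push_cast
    omega

theorem valLabels_zero_isPrefix_readingWord (m : ℕ) (Q : List (ℤ × ℤ)) :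
    valLabels 0 Q <+: readingWord (m + 1) Q := by
  unfold readingWord
  rw [List.range_succ_eq_map]
  simp only [List.map_cons, List.flatten_cons, List.append_assoc, valLabels]
  simp

theorem stepLabels_getElem? {s : Step} {V : ℤ} {L : List (Step × ℤ)} {p : ℕ}
    (h : L[p]? = some (s, V)) :
    (stepLabels s L)[((L.map Prod.fst).take p).count s]? = some V := by
  induction L generalizing p with
  | nil => simp at h
  | cons x L ih =>
    cases p with
    | zero => simp at h; subst h; simp [stepLabels]
    | succ p =>
      have := ih (p := p) (by simpa using h)
      by_cases hx : x.1 = s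
      · simpa [stepLabels, hx] using this
      · simpa [stepLabels, hx, List.count_cons] using this

theorem isValley_iff {β : List Step} {i j : ℕ} :
    IsValley β i j ↔ ∃ p : ℕ, (β ++ [Step.N])[p]? = some Step.E ∧
      (β ++ [Step.N])[p + 1]? = some Step.N ∧ ((β ++ [Step.N]).take p).count Step.E + 1 = i ∧
      ((β ++ [Step.N]).take (p + 1)).count Step.N + 1 = j := by
  unfold IsValley
  constructor
  · rintro (⟨p, h1, h2, h3, h4⟩ | ⟨h1, h2, h3⟩)
    · obtain ⟨hp, -⟩ := List.getElem?_eq_some_iff.1 h2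
      refine ⟨p, ?_, ?_, ?_, ?_⟩
      · rwa [List.getElem?_append_left (by omega)]
      · rwa [List.getElem?_append_left (by omega)]
      · rwa [List.take_append_of_le_length (by omega)]
      · rwa [List.take_append_of_le_length (by omega)]
    · rcases List.eq_nil_or_concat β with rfl | ⟨γ, s, rfl⟩
      · simp at h1
      · obtain rfl : s = Step.E := by simpa using h1
        refine ⟨γ.length, by simp, by simp, by simp [h2], ?_⟩
        rw [List.take_append_of_le_length (by simp), List.take_of_length_le (by simp), h3]
  · rintro ⟨p, h1, h2, h3, h4⟩
    obtain ⟨hp, -⟩ := List.getElem?_eq_some_iff.1 h2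
    simp only [List.length_append, List.length_singleton] at hp
    rw [List.getElem?_append_left (by omega)] at h1
    rw [List.take_append_of_le_length (by omega)] at h3 h4
    rcases Nat.lt_or_ge (p + 1) β.length with h5 | h5
    · rw [List.getElem?_append_left h5] at h2
      exact Or.inl ⟨p, h1, h2, h3, h4⟩
    · right
      obtain rfl : p = β.length - 1 := by omega
      rw [List.take_of_length_le (by omega)] at h4
      refine ⟨by rwa [List.getLast?_eq_getElem?], ?_, h4.symm⟩
      rcases List.eq_nil_or_concat β with rfl | ⟨γ, s, rfl⟩
      · simp at h1
      · obtain rfl : s = Step.E := by simpa using h1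
        simpa using h3.symm

theorem valley_condition_iff {n : ℕ} {w : Fin n → ℤ} {β : List Step} {L : List (Step × ℤ)}
    (hL : L.map Prod.fst = β ++ [Step.N]) (hE : stepLabels Step.E L <+: stepLabels Step.N L)
    (hw : ∀ (k : ℕ) (V : ℤ), (stepLabels Step.N L)[k]? = some V → V = -evalSP w ((n : ℤ) - k)) :
    (∀ i j : ℕ, IsValley β i j →
      evalSP w ((n : ℤ) + 1 - j) < evalSP w ((n : ℤ) + 1 - i)) ↔ L.IsChain ValleyRel := by
  have hlab : ∀ {s : Step} {V : ℤ} {p : ℕ}, L[p]? = some (s, V) →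
      V = -evalSP w ((n : ℤ) - ((β ++ [Step.N]).take p).count s) := by
    intro s V p h
    have h1 := stepLabels_getElem? h
    rw [hL] at h1
    refine hw _ _ ?_
    cases s with
    | N => exact h1
    | E =>
      obtain ⟨hlt, -⟩ := List.getElem?_eq_some_iff.1 h1
      obtain ⟨t, ht⟩ := hE
      rwa [← ht, List.getElem?_append_left hlt]
  rw [List.isChain_iff_getElem]
  constructor
  · intro h p hp h1 h2
    have e1 : L[p]? = some (Step.E, L[p].2) := by
      rw [List.getElem?_eq_getElem (by omega), ← h1]
    have e2 : L[p + 1]? = some (Step.N, L[p + 1].2) := by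
      rw [List.getElem?_eq_getElem (by omega), ← h2]
    have := h _ _ (isValley_iff.2 ⟨p, by rw [← hL, List.getElem?_map, e1]; rfl,
      by rw [← hL, List.getElem?_map, e2]; rfl, rfl, rfl⟩)
    rw [hlab e1, hlab e2]
    push_cast at this
    simp only [add_sub_add_right_eq_sub] at this
    omega
  · intro h i j hij
    obtain ⟨p, h1, h2, rfl, rfl⟩ := isValley_iff.1 hij
    rw [← hL, List.getElem?_map, Option.map_eq_some_iff] at h1 h2
    obtain ⟨⟨s, V⟩, h1, rfl⟩ := h1
    obtain ⟨⟨t, V'⟩, h2, rfl⟩ := h2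
    obtain ⟨hp, h3⟩ := List.getElem?_eq_some_iff.1 h2
    obtain ⟨hp', h4⟩ := List.getElem?_eq_some_iff.1 h1
    have := h p hp
    rw [h3, h4] at this
    have := this rfl rfl
    rw [hlab h1, hlab h2] at this
    push_cast
    simp only [add_sub_add_right_eq_sub]
    omega

/-! ### The ballot property -/

theorem count_take_zetaWord (m : ℕ) (a : List ℤ) (k : ℕ) :
    ((zetaWord m a).take k).count Step.E ≤ ((zetaWord m a).take k).count Step.N + a.count (m : ℤ) := by
  unfold zetaWord
  induction m generalizing k with
  | zero => simp
  | succ m ih =>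
    rw [descFlat_succ, List.take_append, List.count_append, List.count_append]
    rcases le_total k (sPlusL m a).length with hk | hk
    · rw [Nat.sub_eq_zero_of_le hk]
      have := (List.take_sublist k (sPlusL m a)).count_le Step.E
      rw [count_E_sPlusL] at this
      push_cast
      simp
      omega
    · rw [List.take_of_length_le hk, count_N_sPlusL, count_E_sPlusL]
      have := ih (k - (sPlusL m a).length)
      push_cast
      omega

/-! ### Counting paths -/

/-- Binomial coefficients with an integer lower index. -/
def intChoose (m : ℕ) (z : ℤ) : ℕ := if z < 0 then 0 else m.choose z.toNat

theorem intChoose_succ (m : ℕ) (z : ℤ) :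
    intChoose (m + 1) z = intChoose m z + intChoose m (z - 1) := by
  unfold intChoose
  rcases lt_trichotomy z 0 with h | rfl | h
  · rw [if_pos h, if_pos h, if_pos (by omega)]
  · simp
  · obtain ⟨k, rfl⟩ : ∃ k : ℕ, z = k + 1 := ⟨(z - 1).toNat, by omega⟩
    rw [if_neg (by omega), if_neg (by omega), if_neg (by omega)]
    have h1 : ((k : ℤ) + 1).toNat = k + 1 := by omega
    have h2 : ((k : ℤ) + 1 - 1).toNat = k := by omega
    rw [h1, h2, Nat.choose_succ_succ, add_comm]

/-- Words of length `m` that stay nonnegative when started at height `h`. -/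
def ballotFrom (m h : ℕ) : Set (List Step) :=
  {β | β.length = m ∧ ∀ k : ℕ, (β.take k).count Step.E ≤ (β.take k).count Step.N + h}

theorem exists_finset_ballotFrom (m h : ℕ) : ∃ F : Finset (List Step), ballotFrom m h ⊆ F ∧
    F.card ≤ ∑ i ∈ Finset.range (h + 1), intChoose m (((m : ℤ) + h) / 2 - i) := by
  induction m generalizing h with
  | zero =>
    refine ⟨{[]}, ?_, ?_⟩
    · rintro β ⟨hβ, -⟩
      simpa using hβ
    · have h1 : h / 2 ∈ Finset.range (h + 1) := by simp; omega
      refine le_trans ?_ (Finset.single_le_sum (fun _ _ => Nat.zero_le _) h1)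
      have : ((0 : ℕ) + (h : ℤ)) / 2 - (h / 2 : ℕ) = 0 := by push_cast; simp
      rw [this]
      simp [intChoose]
  | succ m ih =>
    obtain ⟨F, hF, hFc⟩ := ih (h + 1)
    have hup : ∀ β ∈ ballotFrom (m + 1) h, ∀ γ, β = Step.N :: γ → γ ∈ ballotFrom m (h + 1) := by
      rintro β ⟨h1, h2⟩ γ rfl
      refine ⟨by simpa using h1, fun k => ?_⟩
      have := h2 (k + 1)
      simp at this
      omega
    have hdown : ∀ β ∈ ballotFrom (m + 1) h, ∀ γ, β = Step.E :: γ →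
        1 ≤ h ∧ γ ∈ ballotFrom m (h - 1) := by
      rintro β ⟨h1, h2⟩ γ rfl
      have h0 : 1 ≤ h := by simpa using h2 1
      refine ⟨h0, by simpa using h1, fun k => ?_⟩
      have := h2 (k + 1)
      simp at this
      omega
    have hsplit : ∀ β ∈ ballotFrom (m + 1) h,
        (∃ γ ∈ ballotFrom m (h + 1), Step.N :: γ = β) ∨
          (1 ≤ h ∧ ∃ γ ∈ ballotFrom m (h - 1), Step.E :: γ = β) := by
      intro β hβ
      rcases β with _ | ⟨_ | _, γ⟩
      · simp [ballotFrom] at hβ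
      · exact Or.inl ⟨γ, hup _ hβ γ rfl, rfl⟩
      · exact Or.inr ⟨(hdown _ hβ γ rfl).1, γ, (hdown _ hβ γ rfl).2, rfl⟩
    have e1 : ((m : ℤ) + ((h + 1 : ℕ) : ℤ)) / 2 = (((m + 1 : ℕ) : ℤ) + h) / 2 := by
      push_cast; congr 1; ring
    rw [e1] at hFc
    set f := (((m + 1 : ℕ) : ℤ) + h) / 2 with hf
    have hshift : ∀ i : ℕ, f - i - 1 = f - ((i + 1 : ℕ) : ℤ) := fun i => by push_cast; ring
    have hsum : ∑ i ∈ Finset.range (h + 1), intChoose (m + 1) (f - i) =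
        ∑ i ∈ Finset.range (h + 2), intChoose m (f - i) +
          ∑ i ∈ Finset.range h, intChoose m (f - 1 - i) := by
      simp only [intChoose_succ, Finset.sum_add_distrib, hshift]
      rw [Finset.sum_range_succ (fun i => intChoose m (f - i)) (h + 1),
        Finset.sum_range_succ (fun i => intChoose m (f - ((i + 1 : ℕ) : ℤ))) h]
      have : ∀ i : ℕ, f - 1 - (i : ℤ) = f - ((i + 1 : ℕ) : ℤ) := fun i => by push_cast; ring
      simp only [this]
      ring
    rw [hsum]
    rcases Nat.eq_zero_or_pos h with rfl | hh
    · refine ⟨F.image (List.cons Step.N), ?_, ?_⟩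
      · intro β hβ
        rcases hsplit β hβ with ⟨γ, hγ, rfl⟩ | ⟨h0, -⟩
        · simpa using hF hγ
        · omega
      · exact (Finset.card_image_le.trans hFc).trans (Nat.le_add_right _ _)
    · obtain ⟨G, hG, hGc⟩ := ih (h - 1)
      have e2 : ((m : ℤ) + ((h - 1 : ℕ) : ℤ)) / 2 = f - 1 := by
        rw [hf]; push_cast [hh]; omega
      rw [e2, Nat.sub_add_cancel hh] at hGc
      refine ⟨F.image (List.cons Step.N) ∪ G.image (List.cons Step.E), ?_, ?_⟩
      · intro β hβ
        rcases hsplit β hβ with ⟨γ, hγ, rfl⟩ | ⟨-, γ, hγ, rfl⟩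
        · simpa using hF hγ
        · simpa using hG hγ
      · exact (Finset.card_union_le _ _).trans
          (add_le_add (Finset.card_image_le.trans hFc) (Finset.card_image_le.trans hGc))

theorem exists_finset_ballot (n : ℕ) : ∃ F : Finset (List Step),
    {β | IsBallotPath (2 * n) β} ⊆ F ∧ F.card ≤ (2 * n).choose n := by
  obtain ⟨F, hF, hc⟩ := exists_finset_ballotFrom (2 * n) 0
  refine ⟨F, hF, ?_⟩
  have : ((2 * n : ℕ) : ℤ) / 2 = n := by push_cast; omega
  simpa [this, intChoose] using hc

theorem exists_finset_latticePath (a b : ℕ) : ∃ F : Finset (List Step),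
    (∀ π ∈ F, IsLatticePath a b π) ∧ F.card = (a + b).choose a := by
  suffices H : ∀ m a b, a + b = m → ∃ F : Finset (List Step),
      (∀ π ∈ F, IsLatticePath a b π) ∧ F.card = (a + b).choose a from H _ a b rfl
  intro m
  induction m with
  | zero =>
    intro a b h
    obtain ⟨rfl, rfl⟩ : a = 0 ∧ b = 0 := by omega
    exact ⟨{[]}, by simp [IsLatticePath], by simp⟩
  | succ m ih =>
    have hinj : ∀ s : Step, Function.Injective (List.cons s) := fun s _ _ h => List.tail_eq_of_cons_eq h
    intro a b h
    rcases Nat.eq_zero_or_pos a with rfl | ha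
    · obtain ⟨F, hF, hc⟩ := ih 0 (b - 1) (by omega)
      refine ⟨F.image (List.cons Step.N), ?_, ?_⟩
      · simp only [Finset.mem_image]
        rintro _ ⟨π, hπ, rfl⟩
        have := hF π hπ
        simp only [IsLatticePath] at this
        simp [IsLatticePath, this]
        omega
      · rw [Finset.card_image_of_injective _ (hinj _), hc]; simp
    · rcases Nat.eq_zero_or_pos b with rfl | hb
      · obtain ⟨F, hF, hc⟩ := ih (a - 1) 0 (by omega)
        refine ⟨F.image (List.cons Step.E), ?_, ?_⟩
        · simp only [Finset.mem_image]
          rintro _ ⟨π, hπ, rfl⟩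
          have := hF π hπ
          simp only [IsLatticePath] at this
          simp [IsLatticePath, this]
          omega
        · rw [Finset.card_image_of_injective _ (hinj _), hc]; simp
      · obtain ⟨F, hF, hFc⟩ := ih (a - 1) b (by omega)
        obtain ⟨G, hG, hGc⟩ := ih a (b - 1) (by omega)
        refine ⟨F.image (List.cons Step.E) ∪ G.image (List.cons Step.N), ?_, ?_⟩
        · simp only [Finset.mem_union, Finset.mem_image]
          rintro _ (⟨π, hπ, rfl⟩ | ⟨π, hπ, rfl⟩)
          · have := hF π hπ
            simp only [IsLatticePath] at this
            simp [IsLatticePath, this]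
            omega
          · have := hG π hπ
            simp only [IsLatticePath] at this
            simp [IsLatticePath, this]
            omega
        · rw [Finset.card_union_of_disjoint, Finset.card_image_of_injective _ (hinj _),
            Finset.card_image_of_injective _ (hinj _), hFc, hGc]
          · obtain ⟨a, rfl⟩ := Nat.exists_eq_succ_of_ne_zero ha.ne'
            obtain ⟨b, rfl⟩ := Nat.exists_eq_succ_of_ne_zero hb.ne'
            have e1 : a.succ - 1 + b.succ = a + b + 1 := by omega
            have e2 : a.succ + (b.succ - 1) = a + b + 1 := by omega
            have e3 : a.succ + b.succ = a + b + 1 + 1 := by omega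
            rw [e1, e2, e3, Nat.succ_sub_one, Nat.choose_succ_succ (a + b + 1) a]
          · rw [Finset.disjoint_left]
            simp only [Finset.mem_image]
            rintro _ ⟨π, -, rfl⟩ ⟨π', -, h⟩
            simp at h

/-- An injective map from lattice paths to ballot paths is surjective. -/
theorem surjOn_ballot {n : ℕ} {f : List Step → List Step}
    (hf : ∀ π, IsLatticePath n n π → IsBallotPath (2 * n) (f π))
    (hinj : Set.InjOn f {π | IsLatticePath n n π}) {β : List Step}
    (hβ : IsBallotPath (2 * n) β) : ∃ π, IsLatticePath n n π ∧ f π = β := by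
  obtain ⟨F, hF, hFc⟩ := exists_finset_ballot n
  obtain ⟨G, hG, hGc⟩ := exists_finset_latticePath n n
  have h1 : G.image f ⊆ F := by
    intro γ hγ
    obtain ⟨π, hπ, rfl⟩ := Finset.mem_image.1 hγ
    exact hF (hf π (hG π hπ))
  have h2 : (G.image f).card = (2 * n).choose n := by
    rw [Finset.card_image_of_injOn, hGc, two_mul]
    exact fun x hx y hy h => hinj (hG x hx) (hG y hy) h
  have h3 := Finset.eq_of_subset_of_card_le h1 (by omega)
  have h4 : β ∈ G.image f := h3 ▸ hF hβ
  obtain ⟨π, hπ, rfl⟩ := Finset.mem_image.1 h4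
  exact ⟨π, hG π hπ, rfl⟩

/-! ### Rows of lattice paths -/

theorem ebn_zero (π : List Step) : ebn π 0 = 0 := by cases π <;> rfl

theorem ebn_cons_E (π : List Step) (k : ℕ) : ebn (Step.E :: π) (k + 1) = ebn π (k + 1) + 1 := rfl

theorem ebn_cons_N (π : List Step) (k : ℕ) : ebn (Step.N :: π) (k + 1) = ebn π k := rfl

theorem ebn_le_succ (π : List Step) (k : ℕ) : ebn π k ≤ ebn π (k + 1) := by
  induction π generalizing k with
  | nil => cases k <;> simp [ebn]
  | cons s π ih =>
    cases k with
    | zero => simp [ebn_zero]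
    | succ k => cases s <;> simp [ebn_cons_E, ebn_cons_N, ih]

theorem ebn_le_count (π : List Step) (k : ℕ) : ebn π k ≤ π.count Step.E := by
  induction π generalizing k with
  | nil => cases k <;> simp [ebn]
  | cons s π ih =>
    cases k with
    | zero => simp [ebn_zero]
    | succ k => cases s <;> simp [ebn_cons_E, ebn_cons_N, ih]

theorem eq_of_ebn_eq {π π' : List Step} (hE : π.count Step.E = π'.count Step.E)
    (hN : π.count Step.N = π'.count Step.N)
    (h : ∀ k, 1 ≤ k → k ≤ π.count Step.N → ebn π k = ebn π' k) : π = π' := by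
  induction π generalizing π' with
  | nil => rcases π' with _ | ⟨_ | _, π'⟩ <;> simp at hE hN ⊢
  | cons s π ih =>
    rcases π' with _ | ⟨s', π'⟩
    · cases s <;> simp at hE hN
    cases s <;> cases s'
    · congr 1
      simp only [List.count_cons_self, List.count_cons_of_ne, ne_eq, reduceCtorEq,
        not_false_eq_true] at hE hN
      refine ih hE (by omega) fun k hk hk' => ?_
      exact h (k + 1) (by omega) (by simpa using hk')
    · have := h 1 le_rfl (by simp)
      rw [ebn_cons_N, ebn_cons_E, ebn_zero] at this
      omega
    · have := h 1 le_rfl (by rw [hN]; simp)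
      rw [ebn_cons_N, ebn_cons_E, ebn_zero] at this
      omega
    · congr 1
      simp only [List.count_cons_self, List.count_cons_of_ne, ne_eq, reduceCtorEq,
        not_false_eq_true] at hE hN
      refine ih (by omega) hN fun k hk hk' => ?_
      have := h k hk (by simpa using hk')
      obtain ⟨k, rfl⟩ := Nat.exists_eq_add_of_le' hk
      simpa [ebn_cons_E] using this

theorem head?_eq_N_iff (π : List Step) :
    π.head? = some Step.N ↔ 1 ≤ π.count Step.N ∧ ebn π 1 = 0 := by
  rcases π with _ | ⟨_ | _, π⟩ <;> simp [ebn_cons_N, ebn_cons_E, ebn_zero]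

theorem isRise_iff (π : List Step) (i : ℕ) :
    IsRise π i ↔ 1 ≤ i ∧ i + 1 ≤ π.count Step.N ∧ ebn π i = ebn π (i + 1) := by
  induction π generalizing i with
  | nil => simp [IsRise]
  | cons s π ih =>
    cases s with
    | E =>
      have h1 : IsRise (Step.E :: π) i ↔ IsRise π i := by
        constructor
        · rintro ⟨_ | p, h1, h2, h3⟩
          · simp at h1
          · exact ⟨p, by simpa using h1, by simpa using h2, by simpa using h3⟩
        · rintro ⟨p, h1, h2, h3⟩
          exact ⟨p + 1, by simpa using h1, by simpa using h2, by simpa using h3⟩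
      rw [h1, ih]
      rcases i with _ | i <;> simp [ebn_cons_E]
    | N =>
      rcases i with _ | _ | i
      · simp [IsRise]
      · have h1 : IsRise (Step.N :: π) 1 ↔ π.head? = some Step.N := by
          constructor
          · rintro ⟨_ | p, h1, h2, h3⟩
            · simpa [List.head?_eq_getElem?] using h2
            · simp at h3
          · intro h
            exact ⟨0, by simp, by simpa [List.head?_eq_getElem?] using h, by simp⟩
        rw [zero_add, h1, head?_eq_N_iff]
        simp [ebn_cons_N, ebn_zero, eq_comm]
      · have h1 : IsRise (Step.N :: π) (i + 1 + 1) ↔ IsRise π (i + 1) := by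
          constructor
          · rintro ⟨_ | p, h1, h2, h3⟩
            · simp at h3
            · exact ⟨p, by simpa using h1, by simpa using h2, by simpa using h3⟩
          · rintro ⟨p, h1, h2, h3⟩
            exact ⟨p + 1, by simpa using h1, by simpa using h2, by simpa using h3⟩
        rw [h1, ih]
        simp [ebn_cons_N]

/-! ### Reflecting the last entry -/

theorem readingWord_reflect (m : ℕ) (Q : List (ℤ × ℤ)) (x V : ℤ) :
    readingWord m (Q ++ [(x, V)]) = readingWord m (Q ++ [(1 - x, -V)]) := by
  unfold readingWord
  congr 2
  funext i
  have h1 : x = -(i : ℤ) ↔ 1 - x = (i : ℤ) + 1 := by omega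
  have h2 : x = (i : ℤ) + 1 ↔ 1 - x = -(i : ℤ) := by omega
  simp only [List.filterMap_append, List.reverse_append, List.reverse_singleton,
    List.singleton_append, List.filterMap_cons, List.filterMap_nil, h1, h2]
  by_cases hx : 1 - x = (i : ℤ) + 1
  · have h3 : ¬ 1 - x = -(i : ℤ) := by omega
    rw [if_pos hx, if_neg h3, if_pos hx]
    simp
  · by_cases hy : 1 - x = -(i : ℤ)
    · rw [if_neg hx, if_pos hy, if_neg hx]
      simp
    · simp only [hx, if_false, hy]

theorem zetaWord_reflect {m : ℕ} (a : List ℤ) {x : ℤ} (hx : 1 ≤ x) (hxm : x ≤ m) :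
    (zetaWord (m + 1) (symVec (a ++ [x]))).dropLast =
      (zetaWord (m + 1) (symVec (a ++ [1 - x]))).dropLast := by
  set e : ℕ → List Step := fun j => sPlusL j [x] with he
  have h1 : ∀ j : ℕ, sPlusL j (symVec (a ++ [x])) = sPlusL j (symVec a) ++ e j := by
    intro j
    rw [symVec_concat, sPlusL_append, sPlusL_cons, if_neg (by omega), if_neg (by omega)]
  have h2 : ∀ j : ℕ, sPlusL j (symVec (a ++ [1 - x])) =
      (e (j + 1) ++ sPlusL j (symVec a)) ++
        if j = 0 then (if x = 1 then [Step.N] else []) else [] := by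
    intro j
    rw [symVec_concat, sPlusL_append, sPlusL_cons]
    have h3 : sPlusL j [1 - x] = if j = 0 then (if x = 1 then [Step.N] else []) else [] := by
      simp only [sPlusL_cons, sPlusL_nil]
      split_ifs <;> first | omega | rfl
    rw [h3]
    congr 1
    simp only [he, sPlusL_cons, sPlusL_nil]
    push_cast
    split_ifs <;> first | omega | simp
  have h3 := descFlat_regroup (m + 1) (fun j : ℕ => sPlusL j (symVec a)) e
  have h4 : e (m + 1) = [] := sPlusL_eq_nil (by simp; omega)
  rw [h4, List.nil_append] at h3
  unfold zetaWord
  simp only [h1, h2]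
  rw [descFlat_append_bottom, h3]
  by_cases hx1 : x = 1
  · simp [he, hx1, sPlusL_cons, sPlusL_nil]
  · have : e 0 = [] := sPlusL_eq_nil (by simp; omega)
    simp [hx1, this]

theorem bind_natCast_eq_map (l : List ℕ) :
    (do let a ← l; pure (a : ℤ)) = l.map (Nat.cast : ℕ → ℤ) := by
  simp [List.map_eq_flatMap]

theorem zetaB_eq (n : ℕ) (π : List Step) :
    zetaB n π = (zetaWord (2 * n + 1) (symVec (areaBList n π))).dropLast := by
  have h0 : sPlusL ((0 : ℕ) : ℤ) (symVec (areaBList n π)) =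
      sMinusR 0 (areaBList n π) ++ (Step.N :: sPlusL 0 (areaBList n π)) := by
    rw [symVec, sPlusL_append, sPlusL_cons, sMinusR_eq]
    simp
  have h1 : ∀ j : ℕ, sPlusL ((j + 1 : ℕ) : ℤ) (symVec (areaBList n π)) =
      sMinusR ((j : ℤ) + 1) (areaBList n π) ++ sPlusL ((j : ℤ) + 1) (areaBList n π) := by
    intro j
    rw [symVec, sPlusL_append, sPlusL_cons, if_neg (by omega), if_neg (by omega), sMinusR_eq]
    push_cast
    rfl
  rw [zetaWord, descFlat_succ', h0]
  simp only [h1]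
  rw [List.dropLast_append_of_ne_nil (by simp), List.dropLast_append_of_ne_nil (by simp)]
  simp only [zetaB, descFlat, List.append_assoc, bind_natCast_eq_map, List.map_map,
    Function.comp_def]

/-! ### The normalized vector of a path -/

/-- The row lengths of a path, with the last one folded into the range up to `n`. -/
def normRow (n : ℕ) (π : List Step) (i : ℕ) : ℤ :=
  if i = n then min (2 * (ebn π n : ℤ) - ebn π (n - 1))
    (2 * (n : ℤ) + 1 - (2 * (ebn π n : ℤ) - ebn π (n - 1)))
  else ebn π i

/-- The sign of the last label under normalization. -/
def normSign (n : ℕ) (π : List Step) : ℤ :=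
  (if (areaBv n π (n - 1) + areaBv n π n) % 2 = 0 then -1 else 1) *
    (if 0 < areaBv n π n then -1 else 1)

/-- The labels after normalization. -/
def normLabel (n : ℕ) (π : List Step) (v : Fin n → ℤ) (j : Fin n) : ℤ :=
  if j.val + 1 = n then normSign n π * v j else v j

/-- The normalized vector of a path with labels. -/
def normPairs (n : ℕ) (π : List Step) (u : Fin n → ℤ) : List (ℤ × ℤ) :=
  (List.finRange n).map fun j => (normRow n π (j.val + 1) - (j.val + 1 : ℕ), u j)

theorem areaBv_of_ne {n i : ℕ} (π : List Step) (h : i ≠ n) : areaBv n π i = ebn π i - i := by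
  simp [areaBv, lamB, h]

theorem areaBv_last (n : ℕ) (π : List Step) :
    areaBv n π n = 2 * (ebn π n : ℤ) - ebn π (n - 1) - n ∨
      areaBv n π n = n + 1 - (2 * (ebn π n : ℤ) - ebn π (n - 1)) := by
  simp only [areaBv, lamB, if_true]
  split_ifs <;> omega

theorem normRow_last (n : ℕ) (π : List Step) :
    normRow n π n - n = if 0 < areaBv n π n then 1 - areaBv n π n else areaBv n π n := by
  simp only [normRow, if_true]
  rcases areaBv_last n π with h | h <;> rw [h] <;> split_ifs <;> omega

theorem normPairs_concat (k : ℕ) (π : List Step) (u : Fin (k + 2) → ℤ) :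
    normPairs (k + 2) π u =
      (List.finRange (k + 1)).map (fun j =>
        (areaBv (k + 2) π (j.val + 1), u j.castSucc)) ++
      [(if 0 < areaBv (k + 2) π (k + 2) then 1 - areaBv (k + 2) π (k + 2)
        else areaBv (k + 2) π (k + 2), u (Fin.last (k + 1)))] := by
  rw [normPairs, List.finRange_succ_last, List.map_append, List.map_map]
  congr 1
  · refine List.map_congr_left fun j _ => ?_
    have : j.val + 1 ≠ k + 2 := by omega
    rw [areaBv_of_ne π this]
    simp only [Function.comp_apply, Fin.val_castSucc, normRow, if_neg this]
  · simp only [List.map_cons, List.map_nil, Fin.val_last]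
    rw [normRow_last]

theorem dBList_eq (k : ℕ) (π : List Step) (v : Fin (k + 2) → ℤ) :
    dBList (k + 2) π v =
      readingWord (4 * (k + 2) + 4) (normPairs (k + 2) π (normLabel (k + 2) π v)) := by
  have h1 : dBList (k + 2) π v = readingWord (4 * (k + 2) + 4)
      ((List.finRange (k + 1)).map (fun j =>
        (areaBv (k + 2) π (j.val + 1), v j.castSucc)) ++
      [(areaBv (k + 2) π (k + 2),
        (if (areaBv (k + 2) π (k + 2 - 1) + areaBv (k + 2) π (k + 2)) % 2 = 0 then -1 else 1) *
          v (Fin.last (k + 1)))]) := by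
    have h2 : (List.finRange (k + 2)).map (fun j => (areaBv (k + 2) π (j.val + 1),
        (if j.val + 1 = k + 2 ∧
          (areaBv (k + 2) π (k + 2 - 1) + areaBv (k + 2) π (k + 2)) % 2 = 0 then -1 else 1) *
          v j)) = (List.finRange (k + 1)).map (fun j =>
        (areaBv (k + 2) π (j.val + 1), v j.castSucc)) ++
      [(areaBv (k + 2) π (k + 2),
        (if (areaBv (k + 2) π (k + 2 - 1) + areaBv (k + 2) π (k + 2)) % 2 = 0 then -1 else 1) *
          v (Fin.last (k + 1)))] := by
      rw [List.finRange_succ_last, List.map_append, List.map_map]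
      congr 1
      · refine List.map_congr_left fun j _ => ?_
        have : j.val ≠ k + 1 := by omega
        simp [this]
      · simp
    rw [← h2, dBList, readingWord]
    simp only [List.filterMap_map, ← List.map_reverse, Function.comp_def, bind_natCast_eq_map,
      List.map_map]
  have h3 : ∀ j : Fin (k + 1), normLabel (k + 2) π v j.castSucc = v j.castSucc := by
    intro j
    have : j.val ≠ k + 1 := by omega
    simp [normLabel, this]
  rw [h1, normPairs_concat]
  simp only [h3]
  have h4 : normLabel (k + 2) π v (Fin.last (k + 1)) =
      normSign (k + 2) π * v (Fin.last (k + 1)) := by simp [normLabel]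
  rw [h4, normSign]
  by_cases hpos : 0 < areaBv (k + 2) π (k + 2)
  · rw [if_pos hpos, if_pos hpos, readingWord_reflect]
    congr 4
    ring
  · rw [if_neg hpos, if_neg hpos, mul_one]

theorem areaBv_last_bounds {n : ℕ} (hn : 1 ≤ n) {π : List Step} (h : IsLatticePath n n π) :
    -(n : ℤ) ≤ areaBv n π n ∧ areaBv n π n ≤ n + 1 := by
  have h1 := ebn_le_count π n
  have h2 := ebn_le_succ π (n - 1)
  rw [Nat.sub_add_cancel hn] at h2
  rw [h.1] at h1
  rcases areaBv_last n π with h | h <;> rw [h] <;> omega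

theorem map_fst_normPairs (k : ℕ) (π : List Step) (u : Fin (k + 2) → ℤ) :
    (normPairs (k + 2) π u).map Prod.fst =
      (List.range (k + 1)).map (fun i => areaBv (k + 2) π (i + 1)) ++
      [if 0 < areaBv (k + 2) π (k + 2) then 1 - areaBv (k + 2) π (k + 2)
        else areaBv (k + 2) π (k + 2)] := by
  rw [normPairs_concat, List.map_append, List.map_map, ← List.map_coe_finRange_eq_range,
    List.map_map]
  rfl

theorem zetaB_eq_normPairs {k : ℕ} {π : List Step} (h : IsLatticePath (k + 2) (k + 2) π)
    (u : Fin (k + 2) → ℤ) :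
    zetaB (k + 2) π = (zetaWord (4 * (k + 2) + 4)
      (symVec ((normPairs (k + 2) π u).map Prod.fst))).dropLast := by
  have hb := areaBv_last_bounds (by omega) h
  have hb' : ∀ i, i < k + 1 → |areaBv (k + 2) π (i + 1)| ≤ k + 2 := by
    intro i hi
    have h1 := ebn_le_count π (i + 1)
    rw [h.1] at h1
    rw [areaBv_of_ne π (by omega), abs_le]
    push_cast
    omega
  have harea : areaBList (k + 2) π =
      (List.range (k + 1)).map (fun i => areaBv (k + 2) π (i + 1)) ++
        [areaBv (k + 2) π (k + 2)] := by
    simp [areaBList, List.range_succ]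
  have hext : zetaWord (4 * (k + 2) + 4) (symVec (areaBList (k + 2) π)) =
      zetaWord (2 * (k + 2) + 1) (symVec (areaBList (k + 2) π)) := by
    refine descFlat_extend (by omega) fun j hj => sPlusL_eq_nil fun x hx => ?_
    have hmem : ∀ y ∈ areaBList (k + 2) π, |y| ≤ k + 3 := by
      intro y hy
      rw [harea, List.mem_append, List.mem_map, List.mem_singleton] at hy
      rcases hy with ⟨i, hi, rfl⟩ | rfl
      · have := hb' i (List.mem_range.1 hi)
        omega
      · rw [abs_le]; push_cast at hb; omega
    rcases mem_symVec hx with rfl | h | h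
    · omega
    · have := abs_le.1 (hmem _ h); omega
    · have := abs_le.1 (hmem _ h); omega
  rw [zetaB_eq, ← hext, harea, map_fst_normPairs]
  split_ifs with hpos
  · exact zetaWord_reflect _ (by omega) (by push_cast at hb ⊢; omega)
  · rfl

/-! ### Evaluating signed permutations -/

theorem evalSP_zero {n : ℕ} (w : Fin n → ℤ) : evalSP w 0 = 0 := by simp [evalSP]

theorem evalSP_succ {n : ℕ} (w : Fin n → ℤ) {i : ℕ} (h : i < n) :
    evalSP w ((i : ℤ) + 1) = w ⟨i, h⟩ := by
  rw [evalSP, dif_pos (by omega)]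
  congr 2
  omega

theorem evalSP_neg {n : ℕ} (w : Fin n → ℤ) (j : ℤ) : evalSP w (-j) = -evalSP w j := by
  unfold evalSP
  simp only [neg_neg]
  split_ifs <;> omega

theorem label_eq_evalSP {n : ℕ} {w : Fin n → ℤ} {z : List ℤ} (hz : z <+: List.ofFn w) {k : ℕ}
    {V : ℤ} (h : ((List.ofFn w).reverse.map (fun x => -x) ++ 0 :: z)[k]? = some V) :
    V = -evalSP w ((n : ℤ) - k) := by
  rcases lt_trichotomy k n with hk | rfl | hk
  · rw [List.getElem?_append_left (by simpa using hk), List.getElem?_map,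
      List.getElem?_reverse (by simpa using hk), List.length_ofFn, List.getElem?_ofFn,
      dif_pos (by omega)] at h
    have e : (n : ℤ) - k = ((n - 1 - k : ℕ) : ℤ) + 1 := by omega
    rw [e, evalSP_succ w (by omega)]
    simpa using h.symm
  · rw [List.getElem?_append_right (by simp)] at h
    simp at h
    simp [evalSP_zero, ← h]
  · rw [List.getElem?_append_right (by simp; omega)] at h
    obtain ⟨i, rfl⟩ : ∃ i, k = n + 1 + i := ⟨k - (n + 1), by omega⟩
    have e : n + 1 + i - ((List.ofFn w).reverse.map (fun x => -x)).length = i + 1 := by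
      simp; omega
    rw [e, List.getElem?_cons_succ] at h
    obtain ⟨t, ht⟩ := hz
    have hi : i < z.length := (List.getElem?_eq_some_iff.1 h).1
    have h2 : (List.ofFn w)[i]? = some V := by rwa [← ht, List.getElem?_append_left hi]
    rw [List.getElem?_ofFn] at h2
    split_ifs at h2 with hin
    have e2 : (n : ℤ) - ((n + 1 + i : ℕ) : ℤ) = -((i : ℤ) + 1) := by push_cast; ring
    rw [e2, evalSP_neg, evalSP_succ w hin, neg_neg]
    exact (Option.some.inj h2).symm

/-! ### The reading word as a signed rearrangement -/

theorem exists_perm_readingWord {n m : ℕ} (c : Fin n → ℤ) (hc : ∀ j, |c j| < m) :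
    ∃ (σ : Equiv.Perm (Fin n)) (ε : Fin n → ℤ), (∀ i, ε i = 1 ∨ ε i = -1) ∧
      ∀ u : Fin n → ℤ, readingWord m ((List.finRange n).map fun j => (c j, u j)) =
        List.ofFn fun i => ε i * u (σ i) := by
  set J : List (Fin n) := ((List.range m).map fun i : ℕ =>
    (List.finRange n).filter (fun j => c j = -(i : ℤ)) ++
    (List.finRange n).reverse.filter (fun j => c j = (i : ℤ) + 1)).flatten with hJ
  have hcount : ∀ j, J.count j = 1 := by
    intro j
    have h1 : ∀ i : ℕ, ((List.finRange n).filter (fun j => c j = -(i : ℤ)) ++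
        (List.finRange n).reverse.filter (fun j => c j = (i : ℤ) + 1)).count j =
        if i = (if c j ≤ 0 then (-c j).toNat else (c j - 1).toNat) then 1 else 0 := by
      intro i
      rw [List.count_append]
      have h2 : ∀ (p : Fin n → Bool) (l : List (Fin n)), l.count j = 1 →
          (l.filter p).count j = if p j then 1 else 0 := by
        intro p l hl
        split_ifs with hp
        · rw [List.count_filter hp, hl]
        · exact List.count_eq_zero_of_not_mem (by simp [hp])
      have h3 : (List.finRange n).count j = 1 :=
        List.count_eq_one_of_mem (List.nodup_finRange n) (List.mem_finRange j)
      rw [h2 _ _ h3, h2 _ _ (by rw [List.count_reverse, h3])]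
      simp only [decide_eq_true_eq]
      split_ifs <;> omega
    rw [hJ, List.count_flatten, List.map_map]
    simp only [Function.comp_def, h1]
    set t := (if c j ≤ 0 then (-c j).toNat else (c j - 1).toNat) with ht
    have htm : t < m := by
      have := abs_lt.1 (hc j)
      rw [ht]
      split_ifs <;> omega
    have hsum : (∑ i ∈ Finset.range m, if i = t then 1 else 0) = 1 := by
      rw [Finset.sum_ite_eq', if_pos (Finset.mem_range.2 htm)]
    exact hsum
  have hperm : J.Perm (List.finRange n) := by
    rw [List.perm_iff_count]
    intro j
    rw [hcount, List.count_eq_one_of_mem (List.nodup_finRange n) (List.mem_finRange j)]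
  have hlen : J.length = n := by simpa using hperm.length_eq
  have hnd : J.Nodup := hperm.nodup_iff.2 (List.nodup_finRange n)
  have hinj : Function.Injective fun i : Fin n => J[i.val]'(by omega) := by
    intro i i' h
    exact Fin.ext ((List.Nodup.getElem_inj_iff hnd).1 h)
  refine ⟨Equiv.ofBijective _ (Finite.injective_iff_bijective.1 hinj),
    fun i => if c (J[i.val]'(by omega)) ≤ 0 then 1 else -1, ?_, ?_⟩
  · intro i
    dsimp only
    split_ifs <;> simp
  · intro u
    have h1 : readingWord m ((List.finRange n).map fun j => (c j, u j)) =
        J.map fun j => (if c j ≤ 0 then 1 else -1) * u j := by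
      rw [readingWord, hJ, List.map_flatten, List.map_map]
      congr 2
      funext i
      simp only [Function.comp, List.map_append, ← List.map_reverse, List.filterMap_map]
      congr 1
      · rw [← List.filterMap_eq_filter, List.map_filterMap]
        congr 1
        funext j
        by_cases h : c j = -(i : ℤ)
        · simp [h, Option.guard]
        · simp [h, Option.guard]
      · rw [← List.filterMap_eq_filter, List.map_filterMap]
        congr 1
        funext j
        by_cases h : c j = (i : ℤ) + 1
        · have : ¬ (i : ℤ) + 1 ≤ 0 := by omega
          simp [h, Option.guard, this]
        · simp [h, Option.guard]
    rw [h1]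
    refine List.ext_getElem (by simp [hlen]) ?_
    intro i h2 h3
    simp

/-! ### Bounds and chain conditions for the normalized vector -/

theorem normRow_zero (k : ℕ) (π : List Step) : normRow (k + 2) π 0 = 0 := by
  simp [normRow, ebn_zero]

theorem zero_cons_normPairs (k : ℕ) (π : List Step) (u : Fin (k + 2) → ℤ) :
    0 :: normPairs (k + 2) π u = (List.range (k + 2 + 1)).map fun i =>
      (normRow (k + 2) π i - (i : ℕ), evalSP u (i : ℕ)) := by
  rw [List.range_succ_eq_map, List.map_cons, List.map_map, ← List.map_coe_finRange_eq_range,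
    List.map_map, normPairs]
  congr 1
  · simp [normRow_zero, evalSP_zero, Prod.ext_iff]
  · refine List.map_congr_left fun j _ => ?_
    have : evalSP u ((j.val + 1 : ℕ) : ℤ) = u j := by
      push_cast
      exact evalSP_succ u j.isLt
    simp only [Function.comp_apply, Nat.succ_eq_add_one, this]

theorem ebn_le {n : ℕ} {π : List Step} (h : IsLatticePath n n π) (i : ℕ) : ebn π i ≤ n :=
  (ebn_le_count π i).trans_eq h.1

theorem normRow_le_succ {k : ℕ} {π : List Step} (h : IsLatticePath (k + 2) (k + 2) π) {i : ℕ}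
    (hi : i < k + 2) : normRow (k + 2) π i ≤ normRow (k + 2) π (i + 1) := by
  have h1 := ebn_le_succ π i
  have h2 := ebn_le h (i + 1)
  rcases Nat.lt_or_ge i (k + 1) with hik | hik
  · rw [normRow, normRow, if_neg (by omega), if_neg (by omega)]
    exact_mod_cast h1
  · obtain rfl : i = k + 1 := by omega
    simp only [normRow, if_true, if_neg (show k + 1 ≠ k + 2 by omega),
      show k + 2 - 1 = k + 1 by omega, show k + 1 + 1 = k + 2 by omega] at *
    omega

theorem normRow_succ_eq_iff {k : ℕ} {π : List Step} (h : IsLatticePath (k + 2) (k + 2) π) {i : ℕ}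
    (hi : i < k + 2) :
    normRow (k + 2) π (i + 1) = normRow (k + 2) π i ↔ ebn π i = ebn π (i + 1) := by
  have h1 := ebn_le_succ π i
  have h2 := ebn_le h (i + 1)
  rcases Nat.lt_or_ge i (k + 1) with hik | hik
  · rw [normRow, normRow, if_neg (by omega), if_neg (by omega)]
    omega
  · obtain rfl : i = k + 1 := by omega
    simp only [normRow, if_true, if_neg (show k + 1 ≠ k + 2 by omega),
      show k + 2 - 1 = k + 1 by omega, show k + 1 + 1 = k + 2 by omega] at *
    omega

theorem normRow_bounds {k : ℕ} {π : List Step} (h : IsLatticePath (k + 2) (k + 2) π) {i : ℕ}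
    (hi : i ≤ k + 2) : 0 ≤ normRow (k + 2) π i ∧ normRow (k + 2) π i ≤ (k + 2 : ℕ) := by
  have h1 := ebn_le h i
  have h2 := ebn_le_succ π (k + 1)
  rw [normRow]
  split_ifs with hik
  · subst hik
    simp only [show k + 2 - 1 = k + 1 by omega, show k + 1 + 1 = k + 2 by omega] at *
    omega
  · omega

theorem slowDescent_normPairs {k : ℕ} {π : List Step} (h : IsLatticePath (k + 2) (k + 2) π)
    (u : Fin (k + 2) → ℤ) : SlowDescent (0 :: (normPairs (k + 2) π u).map Prod.fst) := by
  have : (0 :: (normPairs (k + 2) π u).map Prod.fst) =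
      (0 :: normPairs (k + 2) π u).map Prod.fst := rfl
  rw [this, zero_cons_normPairs, SlowDescent, List.isChain_map, List.isChain_map,
    List.isChain_range_succ]
  intro i hi
  have := normRow_le_succ h hi
  rw [Nat.succ_eq_add_one]
  push_cast
  omega

theorem isChain_riseRel_normPairs {k : ℕ} {π : List Step}
    (h : IsLatticePath (k + 2) (k + 2) π) (u : Fin (k + 2) → ℤ) :
    (0 :: normPairs (k + 2) π u).IsChain RiseRel ↔ ∀ i < k + 2, ebn π i = ebn π (i + 1) →
      evalSP u (i : ℤ) < evalSP u ((i : ℤ) + 1) := by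
  rw [zero_cons_normPairs, List.isChain_map, List.isChain_range_succ]
  refine forall₂_congr fun i hi => ?_
  rw [RiseRel, ← normRow_succ_eq_iff h hi, Nat.succ_eq_add_one]
  push_cast
  refine imp_congr_left ?_
  constructor <;> intro <;> omega

theorem abs_fst_le_of_mem_normPairs {k : ℕ} {π : List Step}
    (h : IsLatticePath (k + 2) (k + 2) π) {u : Fin (k + 2) → ℤ} {x : ℤ × ℤ}
    (hx : x ∈ normPairs (k + 2) π u) : |x.1| ≤ (k + 2 : ℕ) := by
  obtain ⟨j, -, rfl⟩ := List.mem_map.1 hx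
  have := normRow_bounds h (i := j.val + 1) (by omega)
  rw [abs_le]
  push_cast at *
  omega

theorem exists_normPairs_eq_concat {k : ℕ} {π : List Step}
    (u : Fin (k + 2) → ℤ) : ∃ Q y, normPairs (k + 2) π u = Q ++ [y] ∧ y.1 ≤ 0 := by
  refine ⟨_, _, normPairs_concat k π u, ?_⟩
  dsimp only
  split_ifs <;> omega

/-! ### Rises -/

theorem evalSP_normLabel {n : ℕ} (π : List Step) (v : Fin n → ℤ) {i : ℕ} (hi : i < n) :
    evalSP (normLabel n π v) (i : ℤ) = evalSP v (i : ℤ) := by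
  cases i with
  | zero => simp [evalSP_zero]
  | succ i =>
    push_cast
    rw [evalSP_succ _ (by omega), evalSP_succ _ (by omega), normLabel, if_neg (by simp; omega)]

theorem normSign_eq_one {k : ℕ} {π : List Step} (h : IsLatticePath (k + 2) (k + 2) π)
    (heq : ebn π (k + 1) = ebn π (k + 2)) : normSign (k + 2) π = 1 := by
  have h1 := areaBv_of_ne π (show k + 1 ≠ k + 2 by omega)
  have h2 := ebn_le h (k + 2)
  rw [normSign]
  simp only [show k + 2 - 1 = k + 1 by omega]
  rcases areaBv_last (k + 2) π with h3 | h3 <;>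
    simp only [show k + 2 - 1 = k + 1 by omega] at h3 <;> push_cast at h1 h3 <;>
    split_ifs <;> omega

theorem normLabel_eq_self {n : ℕ} {π : List Step} (h : normSign n π = 1) (v : Fin n → ℤ) :
    normLabel n π v = v := by
  funext j
  simp [normLabel, h]

theorem rise_condition_iff {k : ℕ} {π : List Step} (h : IsLatticePath (k + 2) (k + 2) π)
    (v : Fin (k + 2) → ℤ) :
    ((∀ i : ℕ, IsRise π i → evalSP v (i : ℤ) < evalSP v ((i : ℤ) + 1)) ∧
      (π.head? = some Step.N → 0 < evalSP v 1)) ↔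
    (0 :: normPairs (k + 2) π (normLabel (k + 2) π v)).IsChain RiseRel := by
  rw [isChain_riseRel_normPairs h]
  have key : ∀ i < k + 2, ebn π i = ebn π (i + 1) →
      ((evalSP (normLabel (k + 2) π v) (i : ℤ) < evalSP (normLabel (k + 2) π v) ((i : ℤ) + 1)) ↔
        evalSP v (i : ℤ) < evalSP v ((i : ℤ) + 1)) := by
    intro i hi heq
    rcases Nat.lt_or_ge (i + 1) (k + 2) with hik | hik
    · have := evalSP_normLabel π v hik
      push_cast at this
      rw [this, evalSP_normLabel π v hi]
    · obtain rfl : i = k + 1 := by omega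
      rw [normLabel_eq_self (normSign_eq_one h heq)]
  rw [forall₂_congr fun i hi => forall_congr' fun heq => key i hi heq, head?_eq_N_iff, h.2]
  simp only [isRise_iff, h.2]
  constructor
  · rintro ⟨h1, h2⟩ i hi heq
    rcases Nat.eq_zero_or_pos i with rfl | hpos
    · simpa [evalSP_zero] using h2 ⟨by omega, by rw [← heq, ebn_zero]⟩
    · exact h1 i ⟨hpos, by omega, heq⟩
  · intro h1
    refine ⟨fun i hi => h1 i (by omega) hi.2.2, fun h2 => ?_⟩
    simpa [evalSP_zero] using h1 0 (by omega) (by rw [ebn_zero, h2.2])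

/-! ### The diagonal reading word -/

theorem exists_perm_dB {k : ℕ} {π : List Step} (h : IsLatticePath (k + 2) (k + 2) π) :
    ∃ (σ : Equiv.Perm (Fin (k + 2))) (ε : Fin (k + 2) → ℤ), (∀ i, ε i = 1 ∨ ε i = -1) ∧
      ∀ v : Fin (k + 2) → ℤ, dBList (k + 2) π v = List.ofFn (dB (k + 2) π v) ∧
        dB (k + 2) π v = fun i => ε i * v (σ i) := by
  obtain ⟨σ, ε, hε, hσ⟩ := exists_perm_readingWord (m := 4 * (k + 2) + 4)
    (fun j : Fin (k + 2) => normRow (k + 2) π (j.val + 1) - (j.val + 1 : ℕ)) (by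
      intro j
      have := normRow_bounds h (i := j.val + 1) (by omega)
      rw [abs_lt]
      push_cast at *
      omega)
  have hs : normSign (k + 2) π = 1 ∨ normSign (k + 2) π = -1 := by
    rw [normSign]
    split_ifs <;> simp
  have hlist : ∀ v : Fin (k + 2) → ℤ,
      dBList (k + 2) π v = List.ofFn fun i => ε i * normLabel (k + 2) π v (σ i) := by
    intro v
    rw [dBList_eq, ← hσ]
    rfl
  have hfun : ∀ v : Fin (k + 2) → ℤ,
      dB (k + 2) π v = fun i => ε i * normLabel (k + 2) π v (σ i) := by
    intro v
    funext i
    rw [dB, hlist, List.getD_eq_getElem?_getD, List.getElem?_ofFn, dif_pos i.isLt]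
    rfl
  refine ⟨σ, fun i => ε i * if (σ i).val + 1 = k + 2 then normSign (k + 2) π else 1, ?_, ?_⟩
  · intro i
    dsimp only
    split_ifs
    · rcases hε i with h1 | h1 <;> rcases hs with h2 | h2 <;> simp [h1, h2]
    · simpa using hε i
  · intro v
    refine ⟨by rw [hlist, hfun], ?_⟩
    rw [hfun]
    funext i
    simp only [normLabel]
    split_ifs <;> ring

theorem isSignedPerm_comp_iff {n : ℕ} {σ : Equiv.Perm (Fin n)} {ε : Fin n → ℤ}
    (hε : ∀ i, ε i = 1 ∨ ε i = -1) (v : Fin n → ℤ) :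
    IsSignedPerm n (fun i => ε i * v (σ i)) ↔ IsSignedPerm n v := by
  have h1 : ∀ i, |ε i * v (σ i)| = |v (σ i)| := by
    intro i
    rcases hε i with h | h <;> simp [h]
  simp only [IsSignedPerm, h1]
  refine and_congr ⟨fun h i => by simpa using h (σ.symm i), fun h i => h (σ i)⟩ ?_
  exact Function.Injective.of_comp_iff' (fun i => |v i|) σ.bijective

/-! ### The zeta map on paths -/

theorem zetaB_concat_N {k : ℕ} {π : List Step} (h : IsLatticePath (k + 2) (k + 2) π)
    (u : Fin (k + 2) → ℤ) :
    (labZeta (4 * (k + 2) + 4) (symPair (normPairs (k + 2) π u))).map Prod.fst =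
      zetaB (k + 2) π ++ [Step.N] := by
  obtain ⟨Q, y, hQ, hy⟩ := exists_normPairs_eq_concat (π := π) u
  have hs := slowDescent_normPairs h u
  rw [map_fst_labZeta, map_fst_symPair, zetaB_eq_normPairs h u]
  rw [hQ, List.map_append] at hs ⊢
  exact zetaWord_eq_dropLast_concat_N hs hy

theorem stepLabels_N_normPairs {k : ℕ} {π : List Step} (h : IsLatticePath (k + 2) (k + 2) π)
    (v : Fin (k + 2) → ℤ) :
    stepLabels Step.N (labZeta (4 * (k + 2) + 4)
      (symPair (normPairs (k + 2) π (normLabel (k + 2) π v)))) =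
      (List.ofFn (dB (k + 2) π v)).reverse.map (fun x => -x) ++
        0 :: valLabels 0 (normPairs (k + 2) π (normLabel (k + 2) π v)) := by
  obtain ⟨σ, ε, -, hd⟩ := exists_perm_dB h
  rw [stepLabels_N_symPair (m := 4 * (k + 2) + 3), ← dBList_eq, (hd v).1]
  intro x hx
  have := abs_le.1 (abs_fst_le_of_mem_normPairs h hx)
  push_cast at *
  omega

theorem fst_lt_of_mem_symPair {k : ℕ} {π : List Step} (h : IsLatticePath (k + 2) (k + 2) π)
    {u : Fin (k + 2) → ℤ} {y : ℤ × ℤ} (hy : y ∈ symPair (normPairs (k + 2) π u)) :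
    y.1 < (4 * (k + 2) + 4 : ℕ) := by
  have hy' : y.1 ∈ symVec ((normPairs (k + 2) π u).map Prod.fst) := by
    rw [← map_fst_symPair]
    exact List.mem_map_of_mem hy
  have hle : ∀ z ∈ (normPairs (k + 2) π u).map Prod.fst, |z| ≤ (k + 2 : ℕ) := by
    intro z hz
    obtain ⟨x, hx, rfl⟩ := List.mem_map.1 hz
    exact abs_fst_le_of_mem_normPairs h hx
  rcases mem_symVec hy' with h0 | h0 | h0
  · rw [h0]; positivity
  · have := abs_le.1 (hle _ h0); push_cast at *; omega
  · have := abs_le.1 (hle _ h0); push_cast at *; omega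

theorem stepLabels_E_normPairs {k : ℕ} {π : List Step} (h : IsLatticePath (k + 2) (k + 2) π)
    (u : Fin (k + 2) → ℤ) :
    stepLabels Step.E (labZeta (4 * (k + 2) + 4) (symPair (normPairs (k + 2) π u))) ++
      valLabels 0 (symPair (normPairs (k + 2) π u)) =
    stepLabels Step.N (labZeta (4 * (k + 2) + 4) (symPair (normPairs (k + 2) π u))) :=
  stepLabels_E_append _ _ fun _ hy => fst_lt_of_mem_symPair h hy

theorem length_stepLabels (s : Step) (L : List (Step × ℤ)) :
    (stepLabels s L).length = (L.map Prod.fst).count s := by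
  induction L with
  | nil => rfl
  | cons x L ih =>
    rw [stepLabels, List.filterMap_cons, List.map_cons, List.count_cons]
    by_cases hx : x.1 = s
    · simp [hx, ← ih, stepLabels]
    · simp [hx, ← ih, stepLabels]

theorem isBallotPath_zetaB {k : ℕ} {π : List Step} (h : IsLatticePath (k + 2) (k + 2) π) :
    IsBallotPath (2 * (k + 2)) (zetaB (k + 2) π) := by
  set v : Fin (k + 2) → ℤ := 0
  set Q := normPairs (k + 2) π (normLabel (k + 2) π v) with hQ
  have hc := zetaB_concat_N h (normLabel (k + 2) π v)
  have hN := congrArg List.length (stepLabels_N_normPairs h v)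
  have hE := congrArg List.length (stepLabels_E_normPairs h (normLabel (k + 2) π v))
  have hv := congrArg List.length (valLabels_symPair 0 Q)
  rw [← hQ] at hc hN hE
  constructor
  · have hlen := congrArg List.length hc
    have hsum : ∀ l : List Step, l.length = l.count Step.N + l.count Step.E := by
      intro l
      induction l with
      | nil => rfl
      | cons s l ih => cases s <;> simp [ih] <;> omega
    rw [hsum, ← length_stepLabels, ← length_stepLabels] at hlen
    simp at hv hN hE hlen
    omega
  · intro i
    have h0 : ((symPair Q).map Prod.fst).count ((4 * (k + 2) + 4 : ℕ) : ℤ) = 0 := by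
      refine List.count_eq_zero_of_not_mem fun hmem => ?_
      obtain ⟨y, hy, hy'⟩ := List.mem_map.1 hmem
      have := fst_lt_of_mem_symPair h hy
      omega
    have h1 := count_take_zetaWord (4 * (k + 2) + 4) ((symPair Q).map Prod.fst)
      (min i (zetaB (k + 2) π).length)
    rw [← map_fst_labZeta, hc, List.take_append_of_le_length (min_le_right _ _),
      h0, add_zero, ← List.take_take, List.take_length] at h1
    exact h1

theorem zetaB_injOn (k : ℕ) :
    Set.InjOn (zetaB (k + 2)) {π | IsLatticePath (k + 2) (k + 2) π} := by
  intro π hπ π' hπ' heq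
  rw [zetaB_eq_normPairs hπ 0, zetaB_eq_normPairs hπ' 0] at heq
  have key : (normPairs (k + 2) π 0).map Prod.fst = (normPairs (k + 2) π' 0).map Prod.fst := by
    obtain ⟨Q, y, hQ, hy⟩ := exists_normPairs_eq_concat (π := π) (0 : Fin (k + 2) → ℤ)
    obtain ⟨Q', y', hQ', hy'⟩ := exists_normPairs_eq_concat (π := π') (0 : Fin (k + 2) → ℤ)
    have hb : ∀ ρ, IsLatticePath (k + 2) (k + 2) ρ → ∀ z ∈ (normPairs (k + 2) ρ 0).map Prod.fst,
        |z| ≤ (4 * (k + 2) + 3 : ℕ) := by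
      intro ρ hρ z hz
      obtain ⟨x, hx, rfl⟩ := List.mem_map.1 hz
      refine (abs_fst_le_of_mem_normPairs hρ hx).trans ?_
      push_cast
      omega
    have hs := slowDescent_normPairs hπ 0
    have hs' := slowDescent_normPairs hπ' 0
    have hb1 := hb π hπ
    have hb1' := hb π' hπ'
    rw [hQ, List.map_append] at hs hb1 heq ⊢
    rw [hQ', List.map_append] at hs' hb1' heq ⊢
    exact zetaWord_injective hs hy hs' hy' hb1 hb1' heq
  have hrow : ∀ i, 1 ≤ i → i ≤ k + 2 → normRow (k + 2) π i = normRow (k + 2) π' i := by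
    intro i h1 h2
    simp only [normPairs, List.map_map] at key
    have := (List.map_inj_left.1 key) ⟨i - 1, by omega⟩ (List.mem_finRange _)
    simp only [Function.comp_apply, show i - 1 + 1 = i by omega] at this
    omega
  have hlt : ∀ i, i < k + 2 → ebn π i = ebn π' i := by
    intro i hi
    rcases Nat.eq_zero_or_pos i with rfl | hpos
    · rw [ebn_zero, ebn_zero]
    · have := hrow i hpos hi.le
      rw [normRow, normRow, if_neg (by omega), if_neg (by omega)] at this
      exact_mod_cast this
  refine eq_of_ebn_eq (hπ.1.trans hπ'.1.symm) (hπ.2.trans hπ'.2.symm) fun i h1 h2 => ?_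
  rw [hπ.2] at h2
  rcases h2.lt_or_eq with hi | rfl
  · exact hlt i hi
  · have h3 := hrow (k + 2) h1 le_rfl
    simp only [normRow, if_true, hlt (k + 2 - 1) (by omega)] at h3
    omega

theorem vert_iff_valley {k : ℕ} {π : List Step} (h : IsLatticePath (k + 2) (k + 2) π)
    (v : Fin (k + 2) → ℤ) :
    ((∀ i : ℕ, IsRise π i → evalSP v (i : ℤ) < evalSP v ((i : ℤ) + 1)) ∧
      (π.head? = some Step.N → 0 < evalSP v 1)) ↔
    ∀ i j : ℕ, IsValley (zetaB (k + 2) π) i j →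
      evalSP (dB (k + 2) π v) (((k + 2 : ℕ) : ℤ) + 1 - j) <
        evalSP (dB (k + 2) π v) (((k + 2 : ℕ) : ℤ) + 1 - i) := by
  set u := normLabel (k + 2) π v with hu
  rw [rise_condition_iff h, ← hu, valley_condition_iff (zetaB_concat_N h u)
    ⟨_, stepLabels_E_normPairs h u⟩]
  · obtain ⟨Q, y, hQ, hy⟩ := exists_normPairs_eq_concat (π := π) u
    have hs := slowDescent_normPairs h u
    have hb : ∀ x ∈ normPairs (k + 2) π u, |x.1| ≤ (4 * (k + 2) + 3 : ℕ) := fun x hx =>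
      (abs_fst_le_of_mem_normPairs h hx).trans (by push_cast; omega)
    rw [hQ] at hs hb ⊢
    exact (isChain_labZeta hs hy hb).symm
  · intro i V hV
    rw [stepLabels_N_normPairs h v] at hV
    refine label_eq_evalSP ?_ hV
    obtain ⟨σ, ε, -, hd⟩ := exists_perm_dB h
    rw [← (hd v).1, dBList_eq]
    exact valLabels_zero_isPrefix_readingWord _ _

end HLZeta

/-- The Haglund–Loehr zeta map of type `Bₙ` is a bijection from
`Vert(Bₙ) = Vert(Cₙ)` onto `Diag(Bₙ)`. -/
theorem HLzetaB_bijOn (n : ℕ) (hn : 2 ≤ n) :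
    Set.BijOn (fun p : List Step × (Fin n → ℤ) => (zetaB n p.1, dB n p.1 p.2))
      (VertC n) (DiagB n) := by
  obtain ⟨k, rfl⟩ : ∃ k, n = k + 2 := ⟨n - 2, by omega⟩
  refine ⟨?_, ?_, ?_⟩
  · rintro ⟨π, v⟩ ⟨hπ, hv, hrise⟩
    obtain ⟨σ, ε, hε, hd⟩ := HLZeta.exists_perm_dB hπ
    refine ⟨HLZeta.isBallotPath_zetaB hπ, ?_, (HLZeta.vert_iff_valley hπ v).1 hrise⟩
    dsimp only
    rw [(hd v).2]
    exact (HLZeta.isSignedPerm_comp_iff hε v).2 hv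
  · rintro ⟨π, v⟩ ⟨hπ, -⟩ ⟨π', v'⟩ ⟨hπ', -⟩ heq
    obtain ⟨h1, h2⟩ := Prod.mk.inj heq
    obtain rfl : π = π' := HLZeta.zetaB_injOn k hπ hπ' h1
    obtain ⟨σ, ε, hε, hd⟩ := HLZeta.exists_perm_dB hπ
    dsimp only at h2
    rw [(hd v).2, (hd v').2] at h2
    refine Prod.ext rfl (funext fun j => ?_)
    have h3 := congrFun h2 (σ.symm j)
    simp only [Equiv.apply_symm_apply] at h3
    rcases hε (σ.symm j) with h | h <;> simpa [h] using h3
  · rintro ⟨β, w⟩ ⟨hβ, hw, hvalley⟩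
    obtain ⟨π, hπ, rfl⟩ := HLZeta.surjOn_ballot (fun _ => HLZeta.isBallotPath_zetaB)
      (HLZeta.zetaB_injOn k) hβ
    obtain ⟨σ, ε, hε, hd⟩ := HLZeta.exists_perm_dB hπ
    set v : Fin (k + 2) → ℤ := fun j => ε (σ.symm j) * w (σ.symm j) with hv
    have hdv : dB (k + 2) π v = w := by
      rw [(hd v).2]
      funext i
      rcases hε i with h | h <;> simp [hv, h]
    refine ⟨(π, v), ⟨hπ, ?_, ?_⟩, Prod.ext rfl hdv⟩
    · rw [← HLZeta.isSignedPerm_comp_iff hε v, ← (hd v).2, hdv]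
      exact hw
    · refine (HLZeta.vert_iff_valley hπ v).2 ?_
      rw [hdv]
      exact hvalley
end

section
/- Let n ≥ 2, let (π,v) ∈ Vert(B_n), let (β,w) = (ζ_B(π), d_B(π,v)), and let a, b ∈ {v(1),…,v(n)}. Then (π,v) has a rise labelled (a,b) if and only if (β,w) has a valley labelled (b,a) or a valley labelled (−a,−b). Moreover, π begins with a North step if and only if (β,w) has a valley labelled (v(1), 0). -/
/-- `(π,u)` has a rise labelled `(a, b)`. -/
def RiseLabelledC (n : ℕ) (π : List Step) (u : Fin n → ℤ) (a b : ℤ) : Prop :=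
  ∃ i : ℕ, IsRise π i ∧ a = evalSP u (i : ℤ) ∧ b = evalSP u ((i : ℤ) + 1)

/-- `(β,w)` has a valley labelled `(x, y)` (type `Cₙ` labelling convention). -/
def ValleyLabelledC (n : ℕ) (β : List Step) (w : Fin n → ℤ) (x y : ℤ) : Prop :=
  ∃ i j : ℕ, IsValley β i j ∧ x = evalSP w ((n : ℤ) + 1 - i) ∧
    y = if j ≤ n then evalSP w ((n : ℤ) + 1 - j) else evalSP w ((n : ℤ) - j)

/-- `(β,w)` has a valley labelled `(x, y)` (type `Bₙ` labelling convention, `w(0) = 0`). -/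
def ValleyLabB (n : ℕ) (β : List Step) (w : Fin n → ℤ) (x y : ℤ) : Prop :=
  ∃ i j : ℕ, IsValley β i j ∧ x = evalSP w ((n : ℤ) + 1 - i) ∧
    y = evalSP w ((n : ℤ) + 1 - j)

/-! ### Lattice paths -/

theorem ebn_cons_N (π : List Step) (k : ℕ) : ebn (Step.N :: π) (k + 1) = ebn π k := by
  cases k <;> rfl

theorem ebn_cons_E (π : List Step) (k : ℕ) : ebn (Step.E :: π) (k + 1) = ebn π (k + 1) + 1 := rfl

theorem ebn_zero (π : List Step) : ebn π 0 = 0 := by cases π <;> rfl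

theorem ebn_le_count (π : List Step) (k : ℕ) : ebn π k ≤ π.count Step.E := by
  induction π generalizing k with
  | nil => cases k <;> simp [ebn]
  | cons s π ih =>
    cases k with
    | zero => simp [ebn_zero]
    | succ k =>
      cases s with
      | N => simpa [ebn_cons_N] using ih k
      | E => simpa [ebn_cons_E] using ih (k + 1)

theorem ebn_le_succ (π : List Step) (k : ℕ) (hk : k + 1 ≤ π.count Step.N) :
    ebn π k ≤ ebn π (k + 1) := by
  induction π generalizing k with
  | nil => simp at hk
  | cons s π ih =>
    cases k with
    | zero => simp [ebn_zero]
    | succ k =>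
      cases s with
      | N => simpa [ebn_cons_N] using ih k (by simpa using hk)
      | E => simpa [ebn_cons_E] using ih (k + 1) (by simpa using hk)

theorem head_eq_N_iff (π : List Step) (h : 1 ≤ π.count Step.N) :
    π.head? = some Step.N ↔ ebn π 1 = 0 := by
  match π with
  | [] => simp at h
  | Step.N :: π => simp [ebn_cons_N π 0, ebn_zero]
  | Step.E :: π => simp [ebn_cons_E π 0]

theorem isRise_cons_E (π : List Step) (i : ℕ) : IsRise (Step.E :: π) i ↔ IsRise π i := by
  constructor
  · rintro ⟨_ | p, h1, h2, h3⟩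
    · simp at h1
    · exact ⟨p, by simpa using h1, by simpa using h2, by simpa using h3⟩
  · rintro ⟨p, h1, h2, h3⟩
    exact ⟨p + 1, by simpa using h1, by simpa using h2, by simpa using h3⟩

theorem isRise_cons_N (π : List Step) (i : ℕ) :
    IsRise (Step.N :: π) (i + 1) ↔ (i = 0 ∧ π.head? = some Step.N) ∨ IsRise π i := by
  constructor
  · rintro ⟨_ | p, h1, h2, h3⟩
    · exact Or.inl ⟨by simpa using h3.symm, by simpa [List.head?_eq_getElem?] using h2⟩
    · exact Or.inr ⟨p, by simpa using h1, by simpa using h2, by simpa using h3⟩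
  · rintro (⟨rfl, h⟩ | ⟨p, h1, h2, h3⟩)
    · exact ⟨0, by simp, by simpa [List.head?_eq_getElem?] using h, by simp⟩
    · exact ⟨p + 1, by simpa using h1, by simpa using h2, by simpa using h3⟩

theorem isRise_pos {π : List Step} {i : ℕ} (h : IsRise π i) : 1 ≤ i := by
  obtain ⟨p, -, -, h⟩ := h
  omega

theorem isRise_iff (π : List Step) (i : ℕ) :
    IsRise π i ↔ 1 ≤ i ∧ i + 1 ≤ π.count Step.N ∧ ebn π i = ebn π (i + 1) := by
  induction π generalizing i with
  | nil => simp [IsRise]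
  | cons s π ih =>
    cases i with
    | zero => exact ⟨fun h => absurd (isRise_pos h) (by simp), by simp⟩
    | succ i =>
      cases s with
      | E => simp [isRise_cons_E, ih, ebn_cons_E]
      | N =>
        rw [isRise_cons_N, ih, ebn_cons_N, ebn_cons_N]
        rcases Nat.eq_zero_or_pos i with rfl | hi
        · by_cases h : 1 ≤ π.count Step.N
          · simpa [ebn_zero, head_eq_N_iff π h, eq_comm] using fun _ => h
          · have h0 : π.count Step.N = 0 := by omega
            have : π.head? ≠ some Step.N := fun h' =>
              (List.count_eq_zero.mp h0) (List.mem_of_head? h')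
            simp [this, h0]
        · simp [hi.ne', Nat.one_le_iff_ne_zero]

/-! ### Adjacent letters -/

theorem pair_infix_cons {α : Type*} {a b c : α} {l : List α} :
    [a, b] <:+: c :: l ↔ (a = c ∧ l.head? = some b) ∨ [a, b] <:+: l := by
  rw [List.infix_cons_iff]
  cases l <;> simp [List.cons_prefix_cons, eq_comm (a := b)]

theorem pair_infix_append {α : Type*} {a b : α} {l₁ l₂ : List α} :
    [a, b] <:+: l₁ ++ l₂ ↔
      [a, b] <:+: l₁ ∨ (l₁.getLast? = some a ∧ l₂.head? = some b) ∨ [a, b] <:+: l₂ := by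
  induction l₁ with
  | nil => simp
  | cons c l ih =>
    rw [List.cons_append, pair_infix_cons, pair_infix_cons, ih]
    cases l <;> simp [List.getLast?_cons_cons, eq_comm (a := a), or_assoc]

theorem pair_infix_filterMap {α β : Type*} {f : α → Option β} {l : List α} {x y : β} :
    [x, y] <:+: l.filterMap f ↔ ∃ l₁ c l₂ d l₃, l = l₁ ++ c :: (l₂ ++ d :: l₃) ∧
      f c = some x ∧ (∀ e ∈ l₂, f e = none) ∧ f d = some y := by
  constructor
  · rintro ⟨s, t, h⟩
    have h' : l.filterMap f = s ++ x :: y :: t := by rw [← h]; simp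
    obtain ⟨l₀, r, rfl, -, hr⟩ := List.filterMap_eq_append_iff.mp h'
    obtain ⟨l₁, c, r, rfl, -, hc, hr⟩ := List.filterMap_eq_cons_iff.mp hr
    obtain ⟨l₂, d, l₃, rfl, h2, hd, -⟩ := List.filterMap_eq_cons_iff.mp hr
    exact ⟨l₀ ++ l₁, c, l₂, d, l₃, by simp, hc, h2, hd⟩
  · rintro ⟨l₁, c, l₂, d, l₃, rfl, hc, h2, hd⟩
    refine ⟨l₁.filterMap f, l₃.filterMap f, ?_⟩
    simp [hc, hd, List.filterMap_eq_nil_iff.mpr h2]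

theorem getLast?_filterMap_eq_some {α β : Type*} {f : α → Option β} {l : List α} {x : β}
    (h : (l.filterMap f).getLast? = some x) :
    ∃ l₁ c l₂, l = l₁ ++ c :: l₂ ∧ f c = some x ∧ ∀ e ∈ l₂, f e = none := by
  obtain ⟨s, hs⟩ := List.getLast?_eq_some_iff.mp h
  obtain ⟨l₀, r, rfl, -, hr⟩ := List.filterMap_eq_append_iff.mp hs
  obtain ⟨l₁, c, l₂, rfl, -, hc, h2⟩ := List.filterMap_eq_cons_iff.mp hr
  exact ⟨l₀ ++ l₁, c, l₂, by simp, hc, List.filterMap_eq_nil_iff.mp h2⟩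

/-! ### The labelled zeta word

Entries of a labelled area vector are pairs consisting of an area and a label. -/

/-- The word `S→_j^+`, every letter carrying the negated label of its entry. -/
def plusBlock (j : ℤ) (A : List (ℤ × ℤ)) : List (Step × ℤ) :=
  A.filterMap fun c =>
    if c.1 = j then some (Step.N, -c.2) else if c.1 = j + 1 then some (Step.E, -c.2) else none

/-- The word `S←_j^-`, every letter carrying the label of its entry. -/
def minusBlock (j : ℤ) (A : List (ℤ × ℤ)) : List (Step × ℤ) :=
  A.reverse.filterMap fun c =>
    if c.1 = -j then some (Step.N, c.2) else if c.1 = -j - 1 then some (Step.E, c.2) else none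

/-- The concatenation `S←_m^- S→_m^+ ⋯ S←_0^- N S→_0^+` of labelled words, the additional
letter `N` being labelled `0`. -/
def labelledWord (A : List (ℤ × ℤ)) : ℕ → List (Step × ℤ)
  | 0 => minusBlock 0 A ++ (Step.N, 0) :: plusBlock 0 A
  | m + 1 => minusBlock (m + 1) A ++ (plusBlock (m + 1) A ++ labelledWord A m)

/-- The properties of the area vector, normalised by possibly reflecting its last entry, that
govern adjacency of letters in the zeta word. -/
structure IsAreaList (A : List (ℤ × ℤ)) : Prop where
  chain : A.IsChain fun c d => c.1 ≤ d.1 + 1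
  head : ∀ c ∈ A.head?, -1 ≤ c.1
  descend : ∀ A₁ c A₂, A = A₁ ++ c :: A₂ → A₂ ≠ [] → 1 ≤ c.1 → ∃ d ∈ A₂, d.1 = c.1 - 1
  last : ∀ c ∈ A.getLast?, 2 ≤ c.1 → ∃ d ∈ A, d.1 = 1 - c.1

theorem le_of_isChain {A₁ A₂ : List (ℤ × ℤ)} {c : ℤ × ℤ} {k : ℤ}
    (hA : (A₁ ++ c :: A₂).IsChain fun c d => c.1 ≤ d.1 + 1)
    (hhead : ∀ d ∈ (A₁ ++ c :: A₂).head?, k ≤ d.1) (hne : ∀ d ∈ A₁, d.1 ≠ k) : k ≤ c.1 := by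
  induction A₁ with
  | nil => simpa using hhead
  | cons d A₁ ih =>
    rw [List.cons_append, List.isChain_cons] at hA
    refine ih hA.2 (fun e he => ?_) fun e he => hne e (by simp [he])
    have h1 := hA.1 e he
    have h2 : k ≤ d.1 := hhead d (by simp)
    have h3 := hne d (by simp)
    omega

theorem eq_nil_of_isChain {A₁ A₂ A₃ : List (ℤ × ℤ)} {c d : ℤ × ℤ} {k : ℤ}
    (hA : (A₁ ++ c :: (A₂ ++ d :: A₃)).IsChain fun c d => c.1 ≤ d.1 + 1)
    (hc : c.1 = k + 1) (hd : d.1 = k) (hne : ∀ e ∈ A₂, e.1 ≠ k ∧ e.1 ≠ k + 1) : A₂ = [] := by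
  cases A₂ with
  | nil => rfl
  | cons e A₂ =>
    have h := List.isChain_cons.mp (List.isChain_append.mp hA).2.1
    have h1 := h.1 e (by simp)
    have h2 := hne e (by simp)
    have := le_of_isChain (k := k + 1) h.2
      (fun x hx => by
        obtain rfl : e = x := by simpa using hx
        omega)
      fun x hx => (hne x hx).2
    omega

theorem pair_infix_plusBlock {A : List (ℤ × ℤ)} (hA : A.IsChain fun c d => c.1 ≤ d.1 + 1)
    {j x y : ℤ} (h : [(Step.E, x), (Step.N, y)] <:+: plusBlock j A) :
    ∃ c d, [c, d] <:+: A ∧ c.1 = d.1 + 1 ∧ c.2 = -x ∧ d.2 = -y := by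
  obtain ⟨A₁, c, A₂, d, A₃, rfl, hc, h2, hd⟩ := pair_infix_filterMap.mp h
  have hc' : c.1 = j + 1 ∧ c.2 = -x := by
    split_ifs at hc <;> simp at hc; exact ⟨by assumption, by omega⟩
  have hd' : d.1 = j ∧ d.2 = -y := by
    split_ifs at hd <;> simp at hd; exact ⟨by assumption, by omega⟩
  obtain rfl := eq_nil_of_isChain hA hc'.1 hd'.1 fun e he => by
    have := h2 e he
    split_ifs at this; tauto
  exact ⟨c, d, ⟨A₁, A₃, by simp⟩, by omega, hc'.2, hd'.2⟩

theorem pair_infix_minusBlock {A : List (ℤ × ℤ)} (hA : A.IsChain fun c d => c.1 ≤ d.1 + 1)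
    {j x y : ℤ} (h : [(Step.E, x), (Step.N, y)] <:+: minusBlock j A) :
    ∃ c d, [c, d] <:+: A ∧ c.1 = d.1 + 1 ∧ c.2 = y ∧ d.2 = x := by
  obtain ⟨A₁, d, A₂, c, A₃, hl, hd, h2, hc⟩ := pair_infix_filterMap.mp h
  obtain rfl : A = A₃.reverse ++ c :: (A₂.reverse ++ d :: A₁.reverse) := by
    rw [← List.reverse_reverse A, hl]; simp
  have hc' : c.1 = -j - 1 + 1 ∧ c.2 = y := by
    split_ifs at hc <;> simp at hc; exact ⟨by omega, by omega⟩
  have hd' : d.1 = -j - 1 ∧ d.2 = x := by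
    split_ifs at hd <;> simp at hd; exact ⟨by assumption, by omega⟩
  have := eq_nil_of_isChain hA hc'.1 hd'.1 fun e he => by
    have := h2 e (by simpa using he)
    split_ifs at this with h3 h4
    exact ⟨h4, by omega⟩
  exact ⟨c, d, ⟨A₃.reverse, A₁.reverse, by simp [this]⟩, by omega, hc'.2, hd'.2⟩

/-- A word `S←_j^-` with `j ≥ 1` does not end with an East step. -/
theorem getLast?_minusBlock_ne {A : List (ℤ × ℤ)} (hA : IsAreaList A) {j x : ℤ} (hj : 1 ≤ j) :
    (minusBlock j A).getLast? ≠ some (Step.E, x) := by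
  intro h
  obtain ⟨A₁, c, A₂, hl, hc, h2⟩ := getLast?_filterMap_eq_some h
  obtain rfl : A = A₂.reverse ++ c :: A₁.reverse := by
    rw [← List.reverse_reverse A, hl]; simp
  have hc' : c.1 = -j - 1 := by
    split_ifs at hc <;> simp at hc; assumption
  have := le_of_isChain (k := -j) hA.chain (fun d hd => by have := hA.head d hd; omega)
    fun e he => by
      have := h2 e (by simpa using he)
      split_ifs at this; assumption
  omega

theorem getLast?_plusBlock {A : List (ℤ × ℤ)} (hA : IsAreaList A) {j x : ℤ} (hj : 1 ≤ j)
    (h : (plusBlock j A).getLast? = some (Step.E, x)) :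
    (∃ c ∈ A, x = -c.2) ∧ ∃ d ∈ A, d.1 = -j := by
  obtain ⟨A₁, c, A₂, rfl, hc, h2⟩ := getLast?_filterMap_eq_some h
  have hc' : c.1 = j + 1 ∧ x = -c.2 := by
    split_ifs at hc <;> simp at hc; exact ⟨by assumption, by omega⟩
  refine ⟨⟨c, by simp, hc'.2⟩, ?_⟩
  obtain rfl : A₂ = [] := by
    by_contra hne
    obtain ⟨d, hd, hd'⟩ := hA.descend A₁ c A₂ rfl hne (by omega)
    have := h2 d hd
    split_ifs at this; omega
  obtain ⟨d, hd, hd'⟩ := hA.last c (by simp) (by omega)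
  exact ⟨d, hd, by omega⟩

/-- The word `S→_0^+` does not end with two East steps. -/
theorem plusBlock_zero_ne {A : List (ℤ × ℤ)} (hA : IsAreaList A) (s : List (Step × ℤ)) (x y : ℤ) :
    plusBlock 0 A ≠ s ++ [(Step.E, x), (Step.E, y)] := by
  intro h
  obtain ⟨l₀, r, rfl, -, hr⟩ := List.filterMap_eq_append_iff.mp h
  obtain ⟨l₁, c, r, rfl, -, hc, hr⟩ := List.filterMap_eq_cons_iff.mp hr
  obtain ⟨l₂, d, l₃, rfl, h2, hd, h3⟩ := List.filterMap_eq_cons_iff.mp hr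
  rw [List.filterMap_eq_nil_iff] at h3
  have hc' : c.1 = 1 := by
    split_ifs at hc <;> simp at hc; omega
  have hd' : d.1 = 1 := by
    split_ifs at hd <;> simp at hd; omega
  obtain ⟨e, he, he'⟩ := hA.descend (l₀ ++ l₁) c (l₂ ++ d :: l₃) (by simp) (by simp) (by omega)
  have he0 : e.1 = 0 := by omega
  simp only [List.mem_append, List.mem_cons] at he
  rcases he with he | rfl | he
  · simpa [he0] using h2 e he
  · omega
  · simpa [he0] using h3 e he

theorem labelledWord_ne {A : List (ℤ × ℤ)} (hA : IsAreaList A) (m : ℕ) (s : List (Step × ℤ))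
    (x y : ℤ) : labelledWord A m ≠ s ++ [(Step.E, x), (Step.E, y)] := by
  intro h
  obtain ⟨r, hr⟩ : ∃ r, labelledWord A m = r ++ (Step.N, 0) :: plusBlock 0 A := by
    clear h
    induction m with
    | zero => exact ⟨_, rfl⟩
    | succ m ih =>
      obtain ⟨r, hr⟩ := ih
      exact ⟨minusBlock (m + 1) A ++ (plusBlock (m + 1) A ++ r), by simp [labelledWord, hr]⟩
  rw [hr] at h
  rcases List.eq_nil_or_concat (plusBlock 0 A) with h0 | ⟨t, z, h0⟩
  · have := congrArg List.getLast? h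
    simp [h0] at this
  · rcases List.eq_nil_or_concat t with rfl | ⟨t, z', rfl⟩
    · have := congrArg (fun l => l.dropLast.getLast?) h
      simp [h0, List.dropLast_append_of_ne_nil] at this
    · have h1 := congrArg List.getLast? h
      have h2 := congrArg (fun l => l.dropLast.getLast?) h
      rw [h0] at h1 h2
      simp only [List.concat_eq_append, List.append_assoc, List.cons_append, List.nil_append] at h1 h2
      rw [show r ++ (Step.N, (0 : ℤ)) :: (t ++ [z', z]) = (r ++ (Step.N, 0) :: (t ++ [z'])) ++ [z] by simp,
        show s ++ [(Step.E, x), (Step.E, y)] = (s ++ [(Step.E, x)]) ++ [(Step.E, y)] by simp] at h1 h2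
      simp only [List.getLast?_concat, List.dropLast_concat] at h1 h2
      rw [show r ++ (Step.N, (0 : ℤ)) :: (t ++ [z']) = (r ++ (Step.N, 0) :: t) ++ [z'] by simp] at h2
      simp only [List.getLast?_concat, Option.some.injEq] at h1 h2
      subst h1 h2
      exact plusBlock_zero_ne hA t x y (by rw [h0]; simp)

theorem pair_infix_labelledWord {A : List (ℤ × ℤ)} (hA : IsAreaList A) {m : ℕ} {x y : ℤ}
    (h : [(Step.E, x), (Step.N, y)] <:+: labelledWord A m) :
    (∃ c d, [c, d] <:+: A ∧ c.1 = d.1 + 1 ∧ (c.2 = y ∧ d.2 = x ∨ c.2 = -x ∧ d.2 = -y)) ∨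
      (∃ c ∈ A, ∃ d ∈ A, x = -c.2 ∧ y = d.2) ∨ (y = 0 ∧ ∃ c ∈ A, c.1 = -1 ∧ c.2 = x) := by
  have hplus : ∀ {j : ℤ}, [(Step.E, x), (Step.N, y)] <:+: plusBlock j A →
      ∃ c d, [c, d] <:+: A ∧ c.1 = d.1 + 1 ∧ (c.2 = y ∧ d.2 = x ∨ c.2 = -x ∧ d.2 = -y) := by
    intro j h
    obtain ⟨c, d, h1, h2, h3⟩ := pair_infix_plusBlock hA.chain h
    exact ⟨c, d, h1, h2, Or.inr h3⟩
  have hminus : ∀ {j : ℤ}, [(Step.E, x), (Step.N, y)] <:+: minusBlock j A →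
      ∃ c d, [c, d] <:+: A ∧ c.1 = d.1 + 1 ∧ (c.2 = y ∧ d.2 = x ∨ c.2 = -x ∧ d.2 = -y) := by
    intro j h
    obtain ⟨c, d, h1, h2, h3⟩ := pair_infix_minusBlock hA.chain h
    exact ⟨c, d, h1, h2, Or.inl h3⟩
  induction m with
  | zero =>
    rw [labelledWord, pair_infix_append, pair_infix_cons] at h
    rcases h with h | ⟨h, h0⟩ | ⟨h, -⟩ | h
    · exact Or.inl (hminus h)
    · obtain rfl : (0 : ℤ) = y := by simpa using h0
      obtain ⟨l₁, c, l₂, hl, hc, -⟩ := getLast?_filterMap_eq_some h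
      have hc' : c.1 = -1 ∧ c.2 = x := by
        split_ifs at hc <;> simp at hc; exact ⟨by omega, by omega⟩
      exact Or.inr (Or.inr ⟨rfl, c, List.mem_reverse.mp (by simp [hl]), hc'⟩)
    · simp at h
    · exact Or.inl (hplus h)
  | succ m ih =>
    rw [labelledWord, pair_infix_append, pair_infix_append] at h
    rcases h with h | ⟨h, -⟩ | h | ⟨h, hN⟩ | h
    · exact Or.inl (hminus h)
    · exact absurd h (getLast?_minusBlock_ne hA (by omega))
    · exact Or.inl (hplus h)
    · obtain ⟨⟨c, hc, hx⟩, d, hd, hd'⟩ := getLast?_plusBlock hA (by omega) h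
      have hhead : (minusBlock m A).head? = some (Step.N, y) := by
        have hne : minusBlock m A ≠ [] := by
          intro h0
          have := List.filterMap_eq_nil_iff.mp h0 d (by simpa using hd)
          rw [if_neg (by omega), if_pos (by omega)] at this
          simp at this
        obtain ⟨r, hr⟩ : ∃ r, labelledWord A m = minusBlock m A ++ r := by
          cases m with
          | zero => exact ⟨_, rfl⟩
          | succ m => exact ⟨_, by rw [labelledWord]; push_cast; rfl⟩
        rw [hr, List.head?_append] at hN
        cases hb : minusBlock m A with
        | nil => exact absurd hb hne
        | cons z l => simpa [hb] using hN
      obtain ⟨e, he, he'⟩ := List.mem_filterMap.mp (List.mem_of_head? hhead)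
      have : e.2 = y := by
        split_ifs at he' <;> simp at he'; exact he'
      exact Or.inr (Or.inl ⟨c, hc, e, by simpa using he, hx, this.symm⟩)
    · exact ih h

theorem plusBlock_infix_labelledWord (A : List (ℤ × ℤ)) {j m : ℕ} (h : j ≤ m) :
    plusBlock j A <:+: labelledWord A m := by
  induction m with
  | zero =>
    obtain rfl : j = 0 := by omega
    exact ⟨minusBlock 0 A ++ [(Step.N, 0)], [], by simp [labelledWord]⟩
  | succ m ih =>
    rcases Nat.lt_or_ge m j with hj | hj
    · obtain rfl : j = m + 1 := by omega
      exact ⟨minusBlock (m + 1) A, labelledWord A m, by simp [labelledWord]⟩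
    · exact (ih hj).trans ⟨minusBlock (m + 1) A ++ plusBlock (m + 1) A, [], by simp [labelledWord]⟩

theorem minusBlock_infix_labelledWord (A : List (ℤ × ℤ)) {j m : ℕ} (h : j ≤ m) :
    minusBlock j A <:+: labelledWord A m := by
  induction m with
  | zero =>
    obtain rfl : j = 0 := by omega
    exact ⟨[], (Step.N, 0) :: plusBlock 0 A, by simp [labelledWord]⟩
  | succ m ih =>
    rcases Nat.lt_or_ge m j with hj | hj
    · obtain rfl : j = m + 1 := by omega
      exact ⟨[], plusBlock (m + 1) A ++ labelledWord A m, by simp [labelledWord]⟩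
    · exact (ih hj).trans ⟨minusBlock (m + 1) A ++ plusBlock (m + 1) A, [], by simp [labelledWord]⟩

theorem pair_infix_labelledWord_of_infix {A : List (ℤ × ℤ)} {m : ℕ}
    (hm : ∀ c ∈ A, |c.1| ≤ m) {c d : ℤ × ℤ} (h : [c, d] <:+: A) (hcd : c.1 = d.1 + 1) :
    [(Step.E, d.2), (Step.N, c.2)] <:+: labelledWord A m ∨
      [(Step.E, -c.2), (Step.N, -d.2)] <:+: labelledWord A m := by
  have hc := abs_le.mp (hm c (h.subset (by simp)))
  obtain ⟨s, t, rfl⟩ := h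
  rcases le_or_gt c.1 0 with h0 | h0
  · left
    refine List.IsInfix.trans ?_ (minusBlock_infix_labelledWord _ (j := (-c.1).toNat) (by omega))
    refine pair_infix_filterMap.mpr ⟨t.reverse, d, [], c, s.reverse, by simp, ?_, by simp, ?_⟩
    · rw [if_neg (by omega), if_pos (by omega)]
    · rw [if_pos (by omega)]
  · right
    refine List.IsInfix.trans ?_ (plusBlock_infix_labelledWord _ (j := (d.1).toNat) (by omega))
    refine pair_infix_filterMap.mpr ⟨s, c, [], d, t, by simp, ?_, by simp, ?_⟩
    · rw [if_neg (by omega), if_pos (by omega)]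
    · rw [if_pos (by omega)]

theorem pair_infix_labelledWord_zero {c : ℤ × ℤ} (A : List (ℤ × ℤ)) (m : ℕ) (hc : c.1 = -1) :
    [(Step.E, c.2), (Step.N, 0)] <:+: labelledWord (c :: A) m := by
  induction m with
  | zero =>
    rw [labelledWord, pair_infix_append]
    refine Or.inr (Or.inl ⟨?_, by simp⟩)
    simp [minusBlock, hc]
  | succ m ih => exact ih.trans ⟨minusBlock (m + 1) (c :: A) ++ plusBlock (m + 1) (c :: A), [],
      by simp [labelledWord]⟩

/-! ### Reflecting the last entry -/

theorem plusBlock_append (j : ℤ) (A B : List (ℤ × ℤ)) :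
    plusBlock j (A ++ B) = plusBlock j A ++ plusBlock j B := by
  simp [plusBlock]

theorem minusBlock_append (j : ℤ) (A B : List (ℤ × ℤ)) :
    minusBlock j (A ++ B) = minusBlock j B ++ minusBlock j A := by
  simp [minusBlock]

theorem labelledWord_ne_nil (A : List (ℤ × ℤ)) (m : ℕ) : labelledWord A m ≠ [] := by
  induction m with
  | zero => simp [labelledWord]
  | succ m ih => simp [labelledWord, ih]

/-- Reflecting an entry exchanges its contributions to `S→_{j+1}^+` and `S←_j^-`. -/
theorem plusBlock_minusBlock_reflect {j : ℤ} (hj : 0 ≤ j) (x y : ℤ) :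
    plusBlock (j + 1) [(x, y)] ++ minusBlock j [(x, y)] =
      plusBlock (j + 1) [(1 - x, -y)] ++ minusBlock j [(1 - x, -y)] := by
  have h1 : (1 - x = j + 1) ↔ x = -j := by omega
  have h2 : (1 - x = j + 1 + 1) ↔ x = -j - 1 := by omega
  have h3 : (1 - x = -j) ↔ x = j + 1 := by omega
  have h4 : (1 - x = -j - 1) ↔ x = j + 1 + 1 := by omega
  simp only [plusBlock, minusBlock, List.reverse_singleton, List.filterMap_cons, List.filterMap_nil,
    h1, h2, h3, h4, neg_neg]
  split_ifs <;> first | omega | simp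

theorem dropLast_plusBlock_zero_reflect (A : List (ℤ × ℤ)) (x y : ℤ) (s : List (Step × ℤ)) :
    (s ++ plusBlock 0 (A ++ [(x, y)])).dropLast =
      (s ++ plusBlock 0 (A ++ [(1 - x, -y)])).dropLast := by
  have h1 : (1 - x = 0) ↔ x = 1 := by omega
  have h2 : (1 - x = 1) ↔ x = 0 := by omega
  rw [plusBlock_append, plusBlock_append, ← List.append_assoc, ← List.append_assoc]
  generalize s ++ plusBlock 0 A = t
  simp only [plusBlock, List.filterMap_cons, List.filterMap_nil, zero_add, h1, h2]
  split_ifs <;> first | omega | simp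

theorem labelledWord_reflect (A : List (ℤ × ℤ)) (x y : ℤ) (m : ℕ) :
    ∃ U U', labelledWord (A ++ [(x, y)]) m = minusBlock m [(x, y)] ++ U ∧
      labelledWord (A ++ [(1 - x, -y)]) m = minusBlock m [(1 - x, -y)] ++ U' ∧
      U ≠ [] ∧ U' ≠ [] ∧ U.dropLast = U'.dropLast := by
  induction m with
  | zero =>
    refine ⟨_, _, by rw [labelledWord, minusBlock_append, List.append_assoc]; rfl,
      by rw [labelledWord, minusBlock_append, List.append_assoc]; rfl, by simp, by simp, ?_⟩
    rw [List.dropLast_append_of_ne_nil (by simp), List.dropLast_append_of_ne_nil (by simp)]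
    exact congrArg _ (dropLast_plusBlock_zero_reflect A x y [(Step.N, 0)])
  | succ m ih =>
    obtain ⟨U, U', hU, hU', h1, h2, h3⟩ := ih
    refine ⟨minusBlock (m + 1) A ++ (plusBlock (m + 1) A ++
        ((plusBlock (m + 1) [(x, y)] ++ minusBlock m [(x, y)]) ++ U)),
      minusBlock (m + 1) A ++ (plusBlock (m + 1) A ++
        ((plusBlock (m + 1) [(1 - x, -y)] ++ minusBlock m [(1 - x, -y)]) ++ U')),
      ?_, ?_, by simp [h1], by simp [h2], ?_⟩
    · rw [labelledWord, hU, minusBlock_append, plusBlock_append]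
      simp
    · rw [labelledWord, hU', minusBlock_append, plusBlock_append]
      simp
    · rw [← plusBlock_minusBlock_reflect (Int.natCast_nonneg m)]
      simp [List.dropLast_append_of_ne_nil, h1, h2, h3]

theorem dropLast_labelledWord_reflect (A : List (ℤ × ℤ)) {x : ℤ} (y : ℤ) {m : ℕ}
    (hx : |x| < m) :
    (labelledWord (A ++ [(x, y)]) m).dropLast =
      (labelledWord (A ++ [(1 - x, -y)]) m).dropLast := by
  obtain ⟨U, U', hU, hU', h1, h2, h3⟩ := labelledWord_reflect A x y m
  have := abs_lt.mp hx
  have h4 : minusBlock m [(x, y)] = [] := by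
    simp only [minusBlock, List.reverse_singleton, List.filterMap_cons, List.filterMap_nil]
    rw [if_neg (by omega), if_neg (by omega)]
  have h5 : minusBlock m [(1 - x, -y)] = [] := by
    simp only [minusBlock, List.reverse_singleton, List.filterMap_cons, List.filterMap_nil]
    rw [if_neg (by omega), if_neg (by omega)]
  rw [hU, hU', h4, h5, List.nil_append, List.nil_append, h3]

/-! ### The diagonal reading word -/

/-- The labels of the entries `-j`, read from left to right. -/
def diagMinus (j : ℤ) (A : List (ℤ × ℤ)) : List ℤ :=
  A.filterMap fun c => if c.1 = -j then some c.2 else none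

/-- The negated labels of the entries `j`, read from right to left. -/
def diagPlus (j : ℤ) (A : List (ℤ × ℤ)) : List ℤ :=
  A.reverse.filterMap fun c => if c.1 = j then some (-c.2) else none

/-- The diagonal reading word of a labelled area vector, restricted to `m` diagonals. -/
def diagWord (A : List (ℤ × ℤ)) (m : ℕ) : List ℤ :=
  ((List.range m).map fun i => diagMinus (i : ℤ) A ++ diagPlus ((i : ℤ) + 1) A).flatten

theorem diagWord_succ (A : List (ℤ × ℤ)) (m : ℕ) :
    diagWord A (m + 1) = diagWord A m ++ (diagMinus m A ++ diagPlus (m + 1) A) := by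
  simp [diagWord, List.range_succ]

theorem diagWord_reflect (A : List (ℤ × ℤ)) (x y : ℤ) (m : ℕ) :
    diagWord (A ++ [(x, y)]) m = diagWord (A ++ [(1 - x, -y)]) m := by
  unfold diagWord
  congr 1
  refine List.map_congr_left fun i _ => ?_
  have h1 : (1 - x = -(i : ℤ)) ↔ x = i + 1 := by omega
  have h2 : (1 - x = (i : ℤ) + 1) ↔ x = -i := by omega
  simp only [diagMinus, diagPlus, List.filterMap_append, List.reverse_append,
    List.reverse_singleton, List.filterMap_cons, List.filterMap_nil, h1, h2, neg_neg]
  split_ifs <;> first | omega | simp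

theorem diagMinus_eq_nil {A : List (ℤ × ℤ)} {m : ℕ} (hA : ∀ c ∈ A, |c.1| < m) {j : ℤ}
    (hj : m ≤ j) : diagMinus j A = [] := by
  refine List.filterMap_eq_nil_iff.mpr fun c hc => if_neg ?_
  have := abs_lt.mp (hA c hc)
  omega

theorem diagPlus_eq_nil {A : List (ℤ × ℤ)} {m : ℕ} (hA : ∀ c ∈ A, |c.1| < m) {j : ℤ}
    (hj : m ≤ j) : diagPlus j A = [] := by
  refine List.filterMap_eq_nil_iff.mpr fun c hc => if_neg ?_
  have := abs_lt.mp (hA c (by simpa using hc))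
  omega

theorem diagWord_stable {A : List (ℤ × ℤ)} {m k : ℕ} (hA : ∀ c ∈ A, |c.1| < m) (hk : m ≤ k) :
    diagWord A k = diagWord A m := by
  induction k, hk using Nat.le_induction with
  | base => rfl
  | succ k hk ih =>
    rw [diagWord_succ, ih, diagMinus_eq_nil hA (by omega), diagPlus_eq_nil hA (by omega)]
    simp

theorem length_diagWord {A : List (ℤ × ℤ)} {m : ℕ} (hA : ∀ c ∈ A, |c.1| < m) :
    (diagWord A m).length = A.length := by
  have key : ∀ k : ℕ, (diagWord A k).length =
      A.countP fun c => decide (-(k : ℤ) < c.1 ∧ c.1 ≤ (k : ℤ)) := by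
    intro k
    induction k with
    | zero =>
      refine (List.countP_eq_zero.mpr fun c _ => ?_).symm
      simp only [decide_eq_true_eq]
      omega
    | succ k ih =>
      rw [diagWord_succ, List.length_append, ih]
      clear ih hA
      simp only [diagMinus, diagPlus, List.filterMap_reverse, List.length_append,
        List.length_reverse]
      induction A with
      | nil => simp
      | cons c A ih =>
        simp only [List.filterMap_cons, List.countP_cons, decide_eq_true_eq] at ih ⊢
        push_cast at ih ⊢
        split_ifs <;> simp only [List.length_cons] <;> omega
  rw [key, List.countP_eq_length]
  intro c hc
  have := abs_lt.mp (hA c hc)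
  simp only [decide_eq_true_eq]
  omega

/-! ### Labels of the letters -/

/-- The labels of the letters `s` of a labelled word. -/
def letterLabels (s : Step) (l : List (Step × ℤ)) : List ℤ :=
  l.filterMap fun z => if z.1 = s then some z.2 else none

theorem letterLabels_append (s : Step) (l₁ l₂ : List (Step × ℤ)) :
    letterLabels s (l₁ ++ l₂) = letterLabels s l₁ ++ letterLabels s l₂ := by
  simp [letterLabels]

theorem length_letterLabels (s : Step) (l : List (Step × ℤ)) :
    (letterLabels s l).length = (l.map Prod.fst).count s := by
  induction l with
  | nil => rfl
  | cons z l ih =>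
    simp only [letterLabels, List.filterMap_cons, List.map_cons, List.count_cons, beq_iff_eq] at ih ⊢
    split_ifs <;> simp [ih]

theorem letterLabels_N_plusBlock (j : ℤ) (A : List (ℤ × ℤ)) :
    letterLabels Step.N (plusBlock j A) = (diagPlus j A).reverse := by
  simp only [letterLabels, plusBlock, diagPlus, List.filterMap_reverse, List.reverse_reverse,
    List.filterMap_filterMap]
  refine List.filterMap_congr fun c _ => ?_
  split_ifs <;> simp

theorem letterLabels_E_plusBlock (j : ℤ) (A : List (ℤ × ℤ)) :
    letterLabels Step.E (plusBlock j A) = (diagPlus (j + 1) A).reverse := by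
  simp only [letterLabels, plusBlock, diagPlus, List.filterMap_reverse, List.reverse_reverse,
    List.filterMap_filterMap]
  refine List.filterMap_congr fun c _ => ?_
  split_ifs <;> first | omega | simp

theorem letterLabels_N_minusBlock (j : ℤ) (A : List (ℤ × ℤ)) :
    letterLabels Step.N (minusBlock j A) = (diagMinus j A).reverse := by
  simp only [letterLabels, minusBlock, diagMinus, List.filterMap_reverse, List.reverse_inj,
    List.filterMap_filterMap]
  refine List.filterMap_congr fun c _ => ?_
  split_ifs <;> simp

theorem letterLabels_E_minusBlock (j : ℤ) (A : List (ℤ × ℤ)) :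
    letterLabels Step.E (minusBlock j A) = (diagMinus (j + 1) A).reverse := by
  have h : ∀ x : ℤ, x = -(j + 1) ↔ x = -j - 1 := fun x => by omega
  simp only [letterLabels, minusBlock, diagMinus, List.filterMap_reverse, List.reverse_inj,
    List.filterMap_filterMap, h]
  refine List.filterMap_congr fun c _ => ?_
  split_ifs <;> first | omega | simp

theorem letterLabels_N_labelledWord (A : List (ℤ × ℤ)) (m : ℕ) :
    letterLabels Step.N (labelledWord A m) =
      (diagMinus m A).reverse ++ (diagWord A m).reverse ++ 0 :: (diagMinus 0 A).map Neg.neg := by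
  induction m with
  | zero =>
    have h : letterLabels Step.N ((Step.N, 0) :: plusBlock 0 A) =
        0 :: letterLabels Step.N (plusBlock 0 A) := rfl
    rw [labelledWord, letterLabels_append, h, letterLabels_N_minusBlock, letterLabels_N_plusBlock]
    simp only [diagPlus, List.filterMap_reverse, List.reverse_reverse]
    simp [diagWord, diagMinus, List.map_filterMap, apply_ite]
  | succ m ih =>
    rw [labelledWord, letterLabels_append, letterLabels_append, ih, letterLabels_N_minusBlock,
      letterLabels_N_plusBlock, diagWord_succ]
    simp

theorem letterLabels_E_labelledWord (A : List (ℤ × ℤ)) (m : ℕ) :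
    letterLabels Step.E (labelledWord A m) ++ (diagMinus 0 A).reverse =
      (diagMinus (m + 1) A).reverse ++ (diagWord A (m + 1)).reverse := by
  induction m with
  | zero =>
    have h : letterLabels Step.E ((Step.N, 0) :: plusBlock 0 A) =
        letterLabels Step.E (plusBlock 0 A) := rfl
    rw [labelledWord, letterLabels_append, h, letterLabels_E_minusBlock, letterLabels_E_plusBlock]
    simp [diagWord]
  | succ m ih =>
    rw [labelledWord, letterLabels_append, letterLabels_append, List.append_assoc,
      List.append_assoc, ih, letterLabels_E_minusBlock, letterLabels_E_plusBlock,
      diagWord_succ A (m + 1)]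
    simp

theorem letterLabels_prefix {A : List (ℤ × ℤ)} {m : ℕ} (hA : ∀ c ∈ A, |c.1| < m) (hm : 1 ≤ m)
    (s : Step) : letterLabels s (labelledWord A m) <+:
      (diagWord A m).reverse ++ 0 :: (diagWord A m).map Neg.neg := by
  cases s with
  | N =>
    obtain ⟨r, hr⟩ : diagMinus 0 A <+: diagWord A m := by
      obtain ⟨k, rfl⟩ : ∃ k, m = k + 1 := ⟨m - 1, by omega⟩
      simp [diagWord, List.range_succ_eq_map]
    refine ⟨r.map Neg.neg, ?_⟩
    rw [letterLabels_N_labelledWord, diagMinus_eq_nil hA le_rfl]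
    conv_rhs => rw [← hr]
    conv_lhs => rw [← hr]
    simp
  | E =>
    have h := letterLabels_E_labelledWord A m
    rw [diagMinus_eq_nil hA (j := m + 1) (by omega), diagWord_stable hA (Nat.le_succ m),
      List.reverse_nil, List.nil_append] at h
    rw [← h, List.append_assoc]
    exact List.prefix_append _ _

/-! ### Valleys of the truncated word -/

theorem getElem?_letterLabels {s t : List (Step × ℤ)} {F : List ℤ} {z : Step × ℤ}
    (h : letterLabels z.1 (s ++ z :: t) <+: F) : F[(s.map Prod.fst).count z.1]? = some z.2 := by
  obtain ⟨r, rfl⟩ := h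
  have : letterLabels z.1 (s ++ z :: t) = letterLabels z.1 s ++ z.2 :: letterLabels z.1 t := by
    simp [letterLabels]
  rw [this, ← length_letterLabels]
  simp

theorem exists_pair_infix_of_isValley {T : List (Step × ℤ)} {F : List ℤ}
    (hF : ∀ s, letterLabels s T <+: F) (hT : ∀ s x y, T ≠ s ++ [(Step.E, x), (Step.E, y)])
    {i j : ℕ} (h : IsValley (T.map Prod.fst).dropLast i j) :
    ∃ x y, [(Step.E, x), (Step.N, y)] <:+: T ∧ 1 ≤ i ∧ 1 ≤ j ∧
      F[i - 1]? = some x ∧ F[j - 1]? = some y := by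
  suffices ∃ s x y t, T = s ++ (Step.E, x) :: (Step.N, y) :: t ∧
      i = (s.map Prod.fst).count Step.E + 1 ∧ j = (s.map Prod.fst).count Step.N + 1 by
    obtain ⟨s, x, y, t, rfl, rfl, rfl⟩ := this
    refine ⟨x, y, ⟨s, t, by simp⟩, by omega, by omega, ?_, ?_⟩
    · exact getElem?_letterLabels (z := (Step.E, x)) (hF Step.E)
    · have h1 := hF Step.N
      rw [← List.singleton_append, ← List.append_assoc] at h1
      simpa using getElem?_letterLabels (z := (Step.N, y)) h1
  rcases h with ⟨p, h1, h2, h3, h4⟩ | ⟨h1, h2, h3⟩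
  · rw [← List.map_dropLast] at h1 h2 h3 h4
    obtain ⟨⟨s1, x⟩, hx, rfl⟩ : ∃ z, T.dropLast[p]? = some z ∧ z.1 = Step.E := by
      simpa only [List.getElem?_map, Option.map_eq_some_iff] using h1
    obtain ⟨⟨s2, y⟩, hy, rfl⟩ : ∃ z, T.dropLast[p + 1]? = some z ∧ z.1 = Step.N := by
      simpa only [List.getElem?_map, Option.map_eq_some_iff] using h2
    obtain ⟨hp1, hx⟩ := List.getElem?_eq_some_iff.mp hx
    obtain ⟨hp2, hy⟩ := List.getElem?_eq_some_iff.mp hy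
    have hd : T.dropLast = T.dropLast.take p ++ (Step.E, x) :: (Step.N, y) :: T.dropLast.drop (p + 2) := by
      rw [← hx, ← hy, ← List.drop_eq_getElem_cons, ← List.drop_eq_getElem_cons, List.take_append_drop]
    have hne : T ≠ [] := by rintro rfl; simp at hp1
    refine ⟨T.dropLast.take p, x, y, T.dropLast.drop (p + 2) ++ [T.getLast hne], ?_, ?_, ?_⟩
    · conv_lhs => rw [← List.dropLast_append_getLast hne, hd]
      simp
    · rw [List.map_take, h3]
    · rw [List.take_add_one, h1] at h4
      rw [List.map_take, ← h4]
      simp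
  · rcases List.eq_nil_or_concat T with rfl | ⟨T', ⟨s2, y⟩, rfl⟩
    · simp at h1
    · rcases List.eq_nil_or_concat T' with rfl | ⟨s, ⟨s1, x⟩, rfl⟩
      · simp at h1
      · simp only [List.concat_eq_append, List.map_append, List.map_cons, List.map_nil,
          List.dropLast_concat, List.getLast?_concat, Option.some.injEq] at h1 h2 h3
        subst h1
        cases s2 with
        | E => exact absurd (by simp) (hT s x y)
        | N => exact ⟨s, x, y, [], by simp, by simpa using h2, by simpa using h3⟩

theorem exists_isValley_of_pair_infix {T : List (Step × ℤ)} {F : List ℤ}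
    (hF : ∀ s, letterLabels s T <+: F) {x y : ℤ} (h : [(Step.E, x), (Step.N, y)] <:+: T) :
    ∃ i j, IsValley (T.map Prod.fst).dropLast i j ∧ 1 ≤ i ∧ 1 ≤ j ∧
      F[i - 1]? = some x ∧ F[j - 1]? = some y := by
  obtain ⟨s, t, rfl⟩ := h
  refine ⟨(s.map Prod.fst).count Step.E + 1, (s.map Prod.fst).count Step.N + 1, ?_, by omega,
    by omega, ?_, ?_⟩
  · rcases List.eq_nil_or_concat t with rfl | ⟨t, z, rfl⟩
    · right
      have : List.map Prod.fst (s ++ [(Step.E, x), (Step.N, y)] ++ []) =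
        (s.map Prod.fst ++ [Step.E]) ++ [Step.N] := by simp
      rw [this, List.dropLast_concat]
      simp
    · left
      have : List.map Prod.fst (s ++ [(Step.E, x), (Step.N, y)] ++ t.concat z) =
        (s.map Prod.fst ++ Step.E :: Step.N :: t.map Prod.fst) ++ [z.1] := by simp
      rw [this, List.dropLast_concat]
      refine ⟨s.length, ?_, ?_, ?_, ?_⟩
      · simp
      · simp
      · simp
      · simp [List.take_append, List.take_of_length_le]
  · have h1 := hF Step.E
    rw [List.append_assoc] at h1
    exact getElem?_letterLabels (z := (Step.E, x)) h1
  · have h1 := hF Step.N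
    rw [show s ++ [(Step.E, x), (Step.N, y)] ++ t = (s ++ [(Step.E, x)]) ++ (Step.N, y) :: t by simp] at h1
    simpa using getElem?_letterLabels (z := (Step.N, y)) h1

theorem evalSP_eq_of_getElem? {n : ℕ} {D : List ℤ} (hD : D.length = n) {i : ℕ} {x : ℤ}
    (hi : 1 ≤ i) (h : (D.reverse ++ 0 :: D.map Neg.neg)[i - 1]? = some x) :
    evalSP (fun k : Fin n => D.getD k.val 0) ((n : ℤ) + 1 - i) = x := by
  rcases lt_trichotomy i (n + 1) with h1 | rfl | h1
  · rw [List.getElem?_append_left (by simp; omega), List.getElem?_reverse (by omega)] at h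
    rw [evalSP, dif_pos ⟨by omega, by omega⟩]
    have : ((n : ℤ) + 1 - i - 1).toNat = D.length - 1 - (i - 1) := by omega
    simp [this, h]
  · rw [List.getElem?_append_right (by simp; omega)] at h
    rw [evalSP, dif_neg (by omega), dif_neg (by omega)]
    simpa [hD] using h
  · rw [List.getElem?_append_right (by simp; omega), List.length_reverse,
      show i - 1 - D.length = (i - n - 2) + 1 by omega, List.getElem?_cons_succ,
      List.getElem?_map, Option.map_eq_some_iff] at h
    obtain ⟨z, hz, rfl⟩ := h
    obtain ⟨h2, -⟩ := List.getElem?_eq_some_iff.mp hz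
    rw [evalSP, dif_neg (by omega), dif_pos ⟨by omega, by omega⟩]
    have : (-((n : ℤ) + 1 - i) - 1).toNat = i - n - 2 := by omega
    simp only [this, List.getD_eq_getElem?_getD, hz, Option.getD_some]

/-- Valleys of the truncated zeta word, labelled by the diagonal reading word, are exactly the
pairs of adjacent letters `E`, `N` of the labelled word. -/
theorem valleyLabB_iff {A : List (ℤ × ℤ)} (hA : IsAreaList A) {m n : ℕ}
    (hm : ∀ c ∈ A, |c.1| < m) (hm1 : 1 ≤ m) (hn : A.length = n) (x y : ℤ) :
    ValleyLabB n ((labelledWord A m).map Prod.fst).dropLast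
        (fun k : Fin n => (diagWord A m).getD k.val 0) x y ↔
      [(Step.E, x), (Step.N, y)] <:+: labelledWord A m := by
  have hD := (length_diagWord hm).trans hn
  have hF := letterLabels_prefix hm hm1
  constructor
  · rintro ⟨i, j, hv, rfl, rfl⟩
    obtain ⟨x, y, h, hi, hj, hx, hy⟩ :=
      exists_pair_infix_of_isValley hF (labelledWord_ne hA m) hv
    rwa [evalSP_eq_of_getElem? hD hi hx, evalSP_eq_of_getElem? hD hj hy]
  · intro h
    obtain ⟨i, j, hv, hi, hj, hx, hy⟩ := exists_isValley_of_pair_infix hF h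
    exact ⟨i, j, hv, (evalSP_eq_of_getElem? hD hi hx).symm, (evalSP_eq_of_getElem? hD hj hy).symm⟩

/-! ### The area vector of a path -/

theorem exists_eq_of_le_succ_add_one {f : ℕ → ℤ} {i e : ℕ} (hie : i ≤ e) {c : ℤ}
    (hf : ∀ k, i ≤ k → k < e → f k ≤ f (k + 1) + 1) (hi : c ≤ f i) (he : f e ≤ c) :
    ∃ m, i ≤ m ∧ m ≤ e ∧ f m = c := by
  induction e, hie using Nat.le_induction with
  | base => exact ⟨i, le_rfl, le_rfl, le_antisymm he hi⟩
  | succ e hie ih =>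
    rcases he.eq_or_lt with h | h
    · exact ⟨e + 1, by omega, le_rfl, h⟩
    · have := hf e hie (by omega)
      obtain ⟨m, h1, h2, h3⟩ := ih (fun k h1 h2 => hf k h1 (by omega)) (by omega)
      exact ⟨m, h1, by omega, h3⟩

/-- The area vector with its last entry normalised: it differs from the type `Bₙ` area vector
at most by reflecting the last entry. -/
def normArea (n : ℕ) (π : List Step) (i : ℕ) : ℤ :=
  if i = n then 2 * (ebn π n : ℤ) - ebn π (n - 1) - n else (ebn π i : ℤ) - i

theorem normArea_of_ne {n i : ℕ} (π : List Step) (h : i ≠ n) :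
    normArea n π i = (ebn π i : ℤ) - i := if_neg h

theorem normArea_self (n : ℕ) (π : List Step) :
    normArea n π n = 2 * (ebn π n : ℤ) - ebn π (n - 1) - n := if_pos rfl

theorem areaBv_of_ne {n i : ℕ} (π : List Step) (h : i ≠ n) : areaBv n π i = normArea n π i := by
  simp [areaBv, lamB, normArea, h]

theorem areaBv_self_cases (n : ℕ) (π : List Step) :
    areaBv n π n = normArea n π n ∨ areaBv n π n = 1 - normArea n π n := by
  simp only [areaBv, lamB, normArea, if_true]
  split_ifs <;> omega

theorem ebn_le_of_isLatticePath {n : ℕ} {π : List Step} (hπ : IsLatticePath n n π) (i : ℕ) :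
    ebn π i ≤ n :=
  (ebn_le_count π i).trans_eq hπ.1

theorem ebn_le_succ_of_isLatticePath {n : ℕ} {π : List Step} (hπ : IsLatticePath n n π) {i : ℕ}
    (h : i < n) : ebn π i ≤ ebn π (i + 1) :=
  ebn_le_succ π i (by rw [hπ.2]; omega)

theorem isRise_iff_normArea {n : ℕ} {π : List Step} (hπ : IsLatticePath n n π) (i : ℕ) :
    IsRise π i ↔ 1 ≤ i ∧ i < n ∧ normArea n π i = normArea n π (i + 1) + 1 := by
  rw [isRise_iff, hπ.2, Nat.add_one_le_iff (m := n)]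
  refine and_congr_right fun _ => and_congr_right fun h : i < n => ?_
  rw [normArea_of_ne π h.ne]
  rcases (show i + 1 ≤ n from h).eq_or_lt with rfl | h'
  · rw [normArea_self, Nat.add_sub_cancel]
    omega
  · rw [normArea_of_ne π h'.ne]
    omega

theorem normArea_le_succ {n : ℕ} {π : List Step} (hπ : IsLatticePath n n π) {i : ℕ} (h : i < n) :
    normArea n π i ≤ normArea n π (i + 1) + 1 := by
  have := ebn_le_succ_of_isLatticePath hπ h
  rw [normArea_of_ne π h.ne]
  rcases (show i + 1 ≤ n from h).eq_or_lt with rfl | h'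
  · rw [normArea_self, Nat.add_sub_cancel]
    omega
  · rw [normArea_of_ne π h'.ne]
    omega

theorem neg_one_le_normArea_one {n : ℕ} (hn : 2 ≤ n) (π : List Step) : -1 ≤ normArea n π 1 := by
  rw [normArea_of_ne π (by omega)]
  omega

theorem abs_normArea_le {n : ℕ} (hn : 2 ≤ n) {π : List Step} (hπ : IsLatticePath n n π) {i : ℕ}
    (hi : i ≤ n) : |normArea n π i| ≤ n := by
  rw [abs_le]
  have h1 := ebn_le_of_isLatticePath hπ i
  rcases hi.eq_or_lt with rfl | h
  · have h2 := ebn_le_succ_of_isLatticePath hπ (i := i - 1) (by omega)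
    rw [Nat.sub_add_cancel (by omega)] at h2
    rw [normArea_self]
    omega
  · rw [normArea_of_ne π h.ne]
    omega

theorem exists_normArea_eq_sub_one {n : ℕ} {π : List Step} (hπ : IsLatticePath n n π) {i : ℕ}
    (hi : 1 ≤ i) (hin : i < n) (h : 1 ≤ normArea n π i) :
    ∃ m, i < m ∧ m ≤ n ∧ normArea n π m = normArea n π i - 1 := by
  suffices ∃ e, i ≤ e ∧ e ≤ n ∧ normArea n π e ≤ normArea n π i - 1 by
    obtain ⟨e, hie, hen, he⟩ := this
    obtain ⟨m, h1, h2, h3⟩ := exists_eq_of_le_succ_add_one (f := normArea n π) hie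
      (fun k _ hk => normArea_le_succ hπ (i := k) (by omega)) (by omega) he
    refine ⟨m, lt_of_le_of_ne h1 ?_, by omega, h3⟩
    rintro rfl
    omega
  have h1 := ebn_le_of_isLatticePath hπ (n - 1)
  have h2 := ebn_le_of_isLatticePath hπ n
  have h3 := ebn_le_succ_of_isLatticePath hπ (i := n - 1) (by omega)
  rw [Nat.sub_add_cancel (by omega)] at h3
  rcases h1.eq_or_lt with h1 | h1
  · refine ⟨n, hin.le, le_rfl, ?_⟩
    rw [normArea_self]
    omega
  · refine ⟨n - 1, by omega, by omega, ?_⟩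
    rw [normArea_of_ne π (i := n - 1) (by omega)]
    omega

theorem exists_normArea_eq_one_sub {n : ℕ} (hn : 2 ≤ n) {π : List Step}
    (hπ : IsLatticePath n n π) (h : 2 ≤ normArea n π n) :
    ∃ m, 1 ≤ m ∧ m ≤ n ∧ normArea n π m = 1 - normArea n π n := by
  have h1 := neg_one_le_normArea_one hn π
  have h2 := ebn_le_of_isLatticePath hπ n
  obtain ⟨m, h3, h4, h5⟩ := exists_eq_of_le_succ_add_one (f := normArea n π) (i := 1) (e := n - 1)
    (c := 1 - normArea n π n) (by omega) (fun k _ hk => normArea_le_succ hπ (by omega)) (by omega)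
    (by
      rw [normArea_self, normArea_of_ne π (i := n - 1) (by omega)]
      omega)
  exact ⟨m, h3, by omega, h5⟩

/-- The list of pairs `(f i, v i)` for `i = 1, …, n`. -/
def labelledEntries {n : ℕ} (f : ℕ → ℤ) (v : Fin n → ℤ) : List (ℤ × ℤ) :=
  (List.finRange n).map fun k => (f (k.val + 1), v k)

theorem length_labelledEntries {n : ℕ} (f : ℕ → ℤ) (v : Fin n → ℤ) :
    (labelledEntries f v).length = n := by simp [labelledEntries]

theorem getElem_labelledEntries {n : ℕ} (f : ℕ → ℤ) (v : Fin n → ℤ) (k : ℕ)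
    (h : k < (labelledEntries f v).length) :
    (labelledEntries f v)[k] = (f (k + 1), v ⟨k, by simpa [labelledEntries] using h⟩) := by
  simp [labelledEntries]

theorem mem_labelledEntries {n : ℕ} {f : ℕ → ℤ} {v : Fin n → ℤ} {c : ℤ × ℤ} :
    c ∈ labelledEntries f v ↔ ∃ k : Fin n, c = (f (k.val + 1), v k) := by
  simp [labelledEntries, eq_comm]

theorem labelledEntries_succ {n : ℕ} (f : ℕ → ℤ) (v : Fin (n + 1) → ℤ) :
    labelledEntries f v =
      labelledEntries f (fun k : Fin n => v k.castSucc) ++ [(f (n + 1), v (Fin.last n))] := by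
  simp [labelledEntries, List.finRange_succ_last, Function.comp_def]

theorem isAreaList_labelledEntries {n : ℕ} (hn : 2 ≤ n) {π : List Step}
    (hπ : IsLatticePath n n π) (v : Fin n → ℤ) :
    IsAreaList (labelledEntries (normArea n π) v) where
  chain := by
    rw [List.isChain_iff_getElem]
    intro i hi
    rw [getElem_labelledEntries, getElem_labelledEntries]
    rw [length_labelledEntries] at hi
    exact normArea_le_succ hπ (by omega)
  head := by
    intro c hc
    rw [List.head?_eq_getElem?] at hc
    obtain ⟨h, rfl⟩ := List.getElem?_eq_some_iff.mp hc
    rw [getElem_labelledEntries]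
    exact neg_one_le_normArea_one hn π
  descend := by
    intro A₁ c A₂ hA hne hc
    have hlen := congrArg List.length hA
    rw [length_labelledEntries, List.length_append, List.length_cons] at hlen
    have hpos := List.length_pos_iff.mpr hne
    have hget : ∀ k (hk : k < (A₁ ++ c :: A₂).length),
        ((A₁ ++ c :: A₂)[k]).1 = normArea n π (k + 1) := by
      intro k hk
      simp only [← hA]
      rw [getElem_labelledEntries]
    have hc' : c.1 = normArea n π (A₁.length + 1) := by
      rw [← hget A₁.length (by simp)]
      simp
    obtain ⟨m, h1, h2, h3⟩ :=
      exists_normArea_eq_sub_one hπ (i := A₁.length + 1) (by omega) (by omega) (by omega)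
    refine ⟨A₂[m - A₁.length - 2], List.getElem_mem _, ?_⟩
    have h4 := hget (m - 1) (by simp; omega)
    rw [List.getElem_append_right (by omega)] at h4
    simp only [show m - 1 - A₁.length = (m - A₁.length - 2) + 1 by omega, List.getElem_cons_succ,
      show m - 1 + 1 = m by omega] at h4
    omega
  last := by
    intro c hc h
    rw [List.getLast?_eq_getElem?, length_labelledEntries] at hc
    obtain ⟨hk, rfl⟩ := List.getElem?_eq_some_iff.mp hc
    rw [getElem_labelledEntries] at h ⊢
    simp only [show n - 1 + 1 = n by omega] at h ⊢
    obtain ⟨m, h1, h2, h3⟩ := exists_normArea_eq_one_sub hn hπ h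
    refine ⟨_, mem_labelledEntries.mpr ⟨⟨m - 1, by omega⟩, rfl⟩, ?_⟩
    simpa only [show m - 1 + 1 = m by omega] using h3

theorem abs_labelledEntries_lt {n : ℕ} (hn : 2 ≤ n) {π : List Step} (hπ : IsLatticePath n n π)
    (v : Fin n → ℤ) : ∀ c ∈ labelledEntries (normArea n π) v, |c.1| < (2 * n : ℕ) := by
  intro c hc
  obtain ⟨k, rfl⟩ := mem_labelledEntries.mp hc
  have := abs_normArea_le hn hπ (i := k.val + 1) k.isLt
  change |normArea n π (k.val + 1)| < _
  omega

theorem evalSP_natCast_succ {n : ℕ} (v : Fin n → ℤ) {k : ℕ} (hk : k < n) :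
    evalSP v ((k : ℤ) + 1) = v ⟨k, hk⟩ := by
  rw [evalSP, dif_pos ⟨by omega, by omega⟩]
  simp

theorem riseLabelledC_iff {n : ℕ} {π : List Step} (hπ : IsLatticePath n n π) (v : Fin n → ℤ)
    (a b : ℤ) : RiseLabelledC n π v a b ↔
      ∃ c d, [c, d] <:+: labelledEntries (normArea n π) v ∧ c.1 = d.1 + 1 ∧ c.2 = a ∧ d.2 = b := by
  constructor
  · rintro ⟨i, hi, rfl, rfl⟩
    obtain ⟨h1, h2, h3⟩ := (isRise_iff_normArea hπ i).mp hi
    obtain ⟨k, rfl⟩ : ∃ k, i = k + 1 := ⟨i - 1, by omega⟩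
    have hlen := length_labelledEntries (normArea n π) v
    refine ⟨(labelledEntries (normArea n π) v)[k], (labelledEntries (normArea n π) v)[k + 1],
      ⟨(labelledEntries (normArea n π) v).take k, (labelledEntries (normArea n π) v).drop (k + 2),
        ?_⟩, ?_, ?_, ?_⟩
    · rw [List.append_assoc, List.cons_append, List.cons_append, List.nil_append,
        ← List.drop_eq_getElem_cons, ← List.drop_eq_getElem_cons, List.take_append_drop]
    · rw [getElem_labelledEntries, getElem_labelledEntries, h3]
    · rw [getElem_labelledEntries]
      exact_mod_cast (evalSP_natCast_succ v (k := k) (by omega)).symm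
    · rw [getElem_labelledEntries]
      exact_mod_cast (evalSP_natCast_succ v (k := k + 1) (by omega)).symm
  · rintro ⟨c, d, ⟨s, t, h⟩, hcd, rfl, rfl⟩
    have hlen := congrArg List.length h
    rw [length_labelledEntries] at hlen
    simp only [List.length_append, List.length_cons, List.length_nil] at hlen
    have hc : (labelledEntries (normArea n π) v)[s.length]? = some c := by simp [← h]
    have hd : (labelledEntries (normArea n π) v)[s.length + 1]? = some d := by simp [← h]
    obtain ⟨_, rfl⟩ := List.getElem?_eq_some_iff.mp hc
    obtain ⟨_, rfl⟩ := List.getElem?_eq_some_iff.mp hd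
    rw [getElem_labelledEntries, getElem_labelledEntries] at hcd ⊢
    refine ⟨s.length + 1, (isRise_iff_normArea hπ _).mpr ⟨by omega, by omega, hcd⟩, ?_, ?_⟩
    · exact_mod_cast (evalSP_natCast_succ v (k := s.length) (by omega)).symm
    · exact_mod_cast (evalSP_natCast_succ v (k := s.length + 1) (by omega)).symm

/-! ### The zeta map and the reading word in terms of labelled words -/

theorem map_fst_plusBlock (j : ℤ) (A : List (ℤ × ℤ)) :
    (plusBlock j A).map Prod.fst = sPlusL j (A.map Prod.fst) := by
  simp only [plusBlock, sPlusL, List.map_filterMap, List.filterMap_map]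
  refine List.filterMap_congr fun c _ => ?_
  simp only [Function.comp]
  split_ifs <;> rfl

theorem map_fst_minusBlock (j : ℤ) (A : List (ℤ × ℤ)) :
    (minusBlock j A).map Prod.fst = sMinusR j (A.map Prod.fst) := by
  simp only [minusBlock, sMinusR, sMinusL, List.map_filterMap, ← List.map_reverse,
    List.filterMap_map]
  refine List.filterMap_congr fun c _ => ?_
  simp only [Function.comp]
  split_ifs <;> rfl

theorem dropLast_map_fst_labelledWord (A : List (ℤ × ℤ)) (m : ℕ) :
    ((labelledWord A m).map Prod.fst).dropLast =
      (((List.range m).reverse.map (fun jm : ℕ =>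
        sMinusR ((jm : ℤ) + 1) (A.map Prod.fst) ++
          sPlusL ((jm : ℤ) + 1) (A.map Prod.fst))).flatten) ++
      sMinusR 0 (A.map Prod.fst) ++ (Step.N :: sPlusL 0 (A.map Prod.fst)).dropLast := by
  induction m with
  | zero =>
    simp [labelledWord, map_fst_minusBlock, map_fst_plusBlock, List.dropLast_append_of_ne_nil]
  | succ m ih =>
    rw [labelledWord, List.map_append, List.map_append, ← List.append_assoc,
      List.dropLast_append_of_ne_nil (by simpa using labelledWord_ne_nil A m), ih,
      map_fst_minusBlock, map_fst_plusBlock]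
    simp [List.range_succ]

/-- The sign with which `v(j)` enters the reading word on the diagonal of the entry `j`. -/
def readingSign (n : ℕ) (π : List Step) (j : ℕ) : ℤ :=
  if j = n ∧ (areaBv n π (n - 1) + areaBv n π n) % 2 = 0 then -1 else 1

theorem zetaB_eq {n : ℕ} (π : List Step) (v : Fin n → ℤ) :
    zetaB n π = ((labelledWord (labelledEntries (areaBv n π) v) (2 * n)).map Prod.fst).dropLast := by
  have : (labelledEntries (areaBv n π) v).map Prod.fst = areaBList n π := by
    refine List.ext_getElem (by simp [labelledEntries, areaBList]) fun k h1 h2 => ?_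
    simp [labelledEntries, areaBList]
  rw [dropLast_map_fst_labelledWord, this, zetaB]
  simp only [bind_pure_comp, List.map_eq_map, List.map_map, Function.comp_def]

theorem dBList_eq {n : ℕ} (π : List Step) (v : Fin n → ℤ) :
    dBList n π v = diagWord
      (labelledEntries (areaBv n π) fun k => readingSign n π (k.val + 1) * v k) (4 * n + 4) := by
  simp only [dBList, diagWord, diagMinus, diagPlus, labelledEntries, ← List.map_reverse,
    List.filterMap_map]
  rfl

theorem labelledEntries_areaBv {n : ℕ} (hn : 2 ≤ n) (π : List Step) (v : Fin n → ℤ) :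
    ∃ A y, labelledEntries (normArea n π) v = A ++ [(normArea n π n, y)] ∧
      (labelledEntries (areaBv n π) (fun k => readingSign n π (k.val + 1) * v k) =
          A ++ [(normArea n π n, y)] ∨
        labelledEntries (areaBv n π) (fun k => readingSign n π (k.val + 1) * v k) =
          A ++ [(1 - normArea n π n, -y)]) := by
  obtain ⟨n, rfl⟩ : ∃ m, n = m + 1 := ⟨n - 1, by omega⟩
  refine ⟨_, _, labelledEntries_succ _ _, ?_⟩
  have hA : labelledEntries (areaBv (n + 1) π)
      (fun k : Fin n => readingSign (n + 1) π (k.castSucc.val + 1) * v k.castSucc) =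
      labelledEntries (normArea (n + 1) π) fun k : Fin n => v k.castSucc := by
    refine List.map_congr_left fun k _ => ?_
    have := k.isLt
    have hk : ¬(k.castSucc.val + 1 = n + 1 ∧
        (areaBv (n + 1) π (n + 1 - 1) + areaBv (n + 1) π (n + 1)) % 2 = 0) := by
      rw [Fin.val_castSucc]
      omega
    have hs : readingSign (n + 1) π (k.castSucc.val + 1) = 1 := if_neg hk
    beta_reduce
    rw [areaBv_of_ne π (by omega), hs, one_mul]
  rw [labelledEntries_succ, hA]
  have h1 : areaBv (n + 1) π n = (ebn π n : ℤ) - n := by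
    rw [areaBv_of_ne π (by omega), normArea_of_ne π (by omega)]
  have h2 : normArea (n + 1) π (n + 1) = 2 * (ebn π (n + 1) : ℤ) - ebn π n - (n + 1 : ℕ) :=
    normArea_self _ _
  rcases areaBv_self_cases (n + 1) π with h | h
  · left
    rw [Fin.val_last, readingSign, if_neg, one_mul, h]
    rw [Nat.add_sub_cancel, h, h1, h2]
    omega
  · right
    rw [Fin.val_last, readingSign, if_pos, neg_one_mul, h]
    rw [Nat.add_sub_cancel, h, h1, h2]
    omega

theorem abs_reflect_lt {n : ℕ} (hn : 2 ≤ n) {x : ℤ} (hx : |x| ≤ n) :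
    |x| < (2 * n : ℕ) ∧ |1 - x| < (2 * n : ℕ) := by
  rw [abs_le] at hx
  rw [abs_lt, abs_lt]
  omega

theorem zetaB_eq_normArea {n : ℕ} (hn : 2 ≤ n) {π : List Step} (hπ : IsLatticePath n n π)
    (v : Fin n → ℤ) : zetaB n π =
      ((labelledWord (labelledEntries (normArea n π) v) (2 * n)).map Prod.fst).dropLast := by
  rw [zetaB_eq π fun k => readingSign n π (k.val + 1) * v k]
  obtain ⟨A, y, h1, h2 | h2⟩ := labelledEntries_areaBv hn π v
  · rw [h1, h2]
  · rw [h1, h2, ← List.map_dropLast, ← List.map_dropLast, dropLast_labelledWord_reflect A y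
      (abs_reflect_lt hn (abs_normArea_le hn hπ le_rfl)).1]

theorem dBList_eq_normArea {n : ℕ} (hn : 2 ≤ n) {π : List Step} (hπ : IsLatticePath n n π)
    (v : Fin n → ℤ) :
    dBList n π v = diagWord (labelledEntries (normArea n π) v) (2 * n) := by
  rw [dBList_eq, ← diagWord_stable (abs_labelledEntries_lt hn hπ v)
    (show 2 * n ≤ 4 * n + 4 by omega)]
  obtain ⟨A, y, h1, h2 | h2⟩ := labelledEntries_areaBv hn π v
  · rw [h1, h2]
  · rw [h1, h2, ← diagWord_reflect]

theorem valleyLabB_zetaB_iff {n : ℕ} (hn : 2 ≤ n) {π : List Step} (hπ : IsLatticePath n n π)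
    (v : Fin n → ℤ) (x y : ℤ) : ValleyLabB n (zetaB n π) (dB n π v) x y ↔
      [(Step.E, x), (Step.N, y)] <:+: labelledWord (labelledEntries (normArea n π) v) (2 * n) := by
  rw [← valleyLabB_iff (isAreaList_labelledEntries hn hπ v) (abs_labelledEntries_lt hn hπ v)
    (by omega) (length_labelledEntries _ v), zetaB_eq_normArea hn hπ v]
  unfold dB
  rw [dBList_eq_normArea hn hπ v]

theorem IsSignedPerm.ne_neg {n : ℕ} {v : Fin n → ℤ} (hv : IsSignedPerm n v) (i j : Fin n) :
    v i ≠ -v j := by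
  intro h
  obtain rfl : i = j := hv.2 (by simp [h])
  have h0 : v i = 0 := by omega
  simpa [h0] using (hv.1 i).1

/-- Rises of `(π,v) ∈ Vert(Bₙ)` labelled `(a,b)` correspond to valleys
of `(ζ_B(π), d_B(π,v))` labelled `(b,a)` or `(-a,-b)`; and `π` begins with a North step
iff `(ζ_B(π), d_B(π,v))` has a valley labelled `(v(1), 0)`. -/
theorem riseValleyB (n : ℕ) (hn : 2 ≤ n) (π : List Step) (v : Fin n → ℤ)
    (hmem : (π, v) ∈ VertC n) (a b : ℤ) (ha : ∃ i, v i = a) (hb : ∃ i, v i = b) :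
    (RiseLabelledC n π v a b ↔
      (ValleyLabB n (zetaB n π) (dB n π v) b a ∨
        ValleyLabB n (zetaB n π) (dB n π v) (-a) (-b))) ∧
    (π.head? = some Step.N ↔ ValleyLabB n (zetaB n π) (dB n π v) (evalSP v 1) 0) := by
  have hπ : IsLatticePath n n π := hmem.1
  have hv : IsSignedPerm n v := hmem.2.1
  obtain ⟨p, rfl⟩ := ha
  obtain ⟨q, rfl⟩ := hb
  have hsep := hv.ne_neg
  have hA := isAreaList_labelledEntries hn hπ v
  have hbound : ∀ c ∈ labelledEntries (normArea n π) v, |c.1| ≤ (2 * n : ℕ) := fun c hc =>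
    (abs_labelledEntries_lt hn hπ v c hc).le
  have hlabel : ∀ c ∈ labelledEntries (normArea n π) v, ∃ k, c.2 = v k := fun c hc => by
    obtain ⟨k, rfl⟩ := mem_labelledEntries.mp hc
    exact ⟨k, rfl⟩
  simp only [valleyLabB_zetaB_iff hn hπ]
  constructor
  · rw [riseLabelledC_iff hπ]
    constructor
    · rintro ⟨c, d, h, hcd, hc, hd⟩
      rw [← hc, ← hd]
      exact pair_infix_labelledWord_of_infix hbound h hcd
    · rintro (h | h)
      · rcases pair_infix_labelledWord hA h with
          ⟨c, d, h, hcd, ⟨h1, h2⟩ | ⟨h1, -⟩⟩ | ⟨c, hc, d, hd, h1, h2⟩ | ⟨h0, -⟩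
        · exact ⟨c, d, h, hcd, h1, h2⟩
        · obtain ⟨k, hk⟩ := hlabel c (h.subset (by simp))
          exact absurd (hk ▸ h1) (hsep k q)
        · obtain ⟨k, hk⟩ := hlabel c hc
          exact absurd (hk ▸ h1) (hsep q k)
        · exact absurd (by omega) (hsep p p)
      · rcases pair_infix_labelledWord hA h with
          ⟨c, d, h, hcd, ⟨h1, -⟩ | ⟨h1, h2⟩⟩ | ⟨c, hc, d, hd, h1, h2⟩ | ⟨h0, -⟩
        · obtain ⟨k, hk⟩ := hlabel c (h.subset (by simp))
          exact absurd (hk ▸ h1) (hsep k q)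
        · exact ⟨c, d, h, hcd, by omega, by omega⟩
        · obtain ⟨k, hk⟩ := hlabel d hd
          exact absurd (hk ▸ h2.symm) (hsep k q)
        · exact absurd (by omega) (hsep q q)
  · have hv1 : evalSP v 1 = v ⟨0, by omega⟩ := by
      simpa using evalSP_natCast_succ v (k := 0) (by omega)
    have harea : π.head? = some Step.N ↔ normArea n π 1 = -1 := by
      rw [head_eq_N_iff π (by rw [hπ.2]; omega), normArea_of_ne π (by omega)]
      omega
    rw [hv1, harea]
    constructor
    · intro h
      obtain ⟨m, rfl⟩ : ∃ m, n = m + 1 := ⟨n - 1, by omega⟩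
      have := pair_infix_labelledWord_zero (c := (normArea (m + 1) π 1, v 0))
        ((List.finRange m).map fun k => (normArea (m + 1) π (k.succ.val + 1), v k.succ))
        (2 * (m + 1)) h
      simpa [labelledEntries, List.finRange_succ, Function.comp_def] using this
    · intro h
      rcases pair_infix_labelledWord hA h with
        ⟨c, d, h, -, ⟨h1, -⟩ | ⟨-, h1⟩⟩ | ⟨c, hc, d, hd, -, h1⟩ | ⟨-, c, hc, h1, h2⟩
      · obtain ⟨k, hk⟩ := hlabel c (h.subset (by simp))
        exact absurd (by omega) (hsep k k)
      · obtain ⟨k, hk⟩ := hlabel d (h.subset (by simp))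
        exact absurd (by omega) (hsep k k)
      · obtain ⟨k, hk⟩ := hlabel d hd
        exact absurd (by omega) (hsep k k)
      · obtain ⟨k, rfl⟩ := mem_labelledEntries.mp hc
        have hk : k = ⟨0, by omega⟩ := hv.2 (congrArg abs h2)
        simpa [hk] using h1
end
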